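/- Let T be a strongly almost periodic distribution on ℝ^d that is also a tempered distribution, and let S = {k ∈ ℝ^d : a_k(T) ≠ 0} be its Fourier–Bohr spectrum. Then S is at most countable, and the following are equivalent: (i) the distributional Fourier transform T̂ ∈ 𝒮′(ℝ^d) is a measure; (ii) for every compact K ⊂ ℝ^d, the sum Σ_{k ∈ S∩K} |a_k(T)| is finite. If either holds, then T̂ = Σ_{k∈S} a_k(T) δ_k in the sense of measures. -/

import Mathlib

set_option linter.unusedSectionVars false

open MeasureTheory Filter Metric Complex SchwartzMap
open scoped Topology ENNReal NNReal ComplexConjugate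

noncomputable section

section Preamble

variable {E : Type*} [NormedAddCommGroup E] [InnerProductSpace ℝ E] [FiniteDimensional ℝ E]
  [MeasurableSpace E] [BorelSpace E]

/-- A set is relatively dense if it has bounded gaps. -/
def IsRelativelyDense (A : Set E) : Prop :=
  ∃ r : ℝ, ∀ x : E, ∃ a ∈ A, dist x a ≤ r

/-- Bohr almost periodic functions: uniformly continuous, bounded, with relatively
dense sets of ε-almost periods. -/
def IsBohrAP (f : E → ℂ) : Prop :=
  UniformContinuous f ∧ (∃ C : ℝ, ∀ x, ‖f x‖ ≤ C) ∧
    ∀ ε : ℝ, 0 < ε → IsRelativelyDense {t : E | ∀ x, ‖f (x - t) - f x‖ < ε}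

/-- Bounded functions. -/
def IsBddFun (f : E → ℂ) : Prop := ∃ C : ℝ, ∀ x, ‖f x‖ ≤ C

lemma isometry_const_sub (x : E) : Isometry (fun y : E => x - y) :=
  Isometry.of_dist_eq (fun a b => dist_sub_left x a b)

lemma hasTemperateGrowth_const_sub (x : E) :
    Function.HasTemperateGrowth (fun y : E => x - y) := by
  apply Function.HasTemperateGrowth.of_fderiv (k := 1) (C := ‖x‖ + 1)
  · have h : (fderiv ℝ (fun y : E => x - y)) =
        fun _ : E => ((0 : E →L[ℝ] E) - ContinuousLinearMap.id ℝ E) := by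
      funext y
      exact ((hasFDerivAt_const x y).sub (hasFDerivAt_id y)).fderiv
    rw [h]
    exact Function.HasTemperateGrowth.const _
  · exact (differentiable_const x).sub differentiable_id
  · intro y
    have h1 : ‖x - y‖ ≤ ‖x‖ + ‖y‖ := norm_sub_le x y
    have h2 : (0:ℝ) ≤ ‖x‖ := norm_nonneg x
    have h3 : (0:ℝ) ≤ ‖y‖ := norm_nonneg y
    calc ‖x - y‖ ≤ ‖x‖ + ‖y‖ := h1
      _ ≤ (‖x‖ + 1) * (1 + ‖y‖) ^ 1 := by nlinarith

/-- The reflected translate `y ↦ ψ (x - y)` of a Schwartz function. -/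
def transRefl (x : E) (ψ : SchwartzMap E ℂ) : SchwartzMap E ℂ :=
  SchwartzMap.compCLMOfAntilipschitz (K := 1) ℝ (hasTemperateGrowth_const_sub x)
    (isometry_const_sub x).antilipschitz ψ

@[simp] lemma transRefl_apply (x : E) (ψ : SchwartzMap E ℂ) (y : E) :
    transRefl x ψ y = ψ (x - y) := rfl

/-- Convolution of a tempered distribution with a Schwartz function:
`(T * ψ)(x) = T (ψ (x - ·))`. -/
def convTD (T : SchwartzMap E ℂ →L[ℂ] ℂ) (ψ : SchwartzMap E ℂ) : E → ℂ :=
  fun x => T (transRefl x ψ)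

/-- Smooth compactly supported test function, regarded inside the Schwartz space. -/
def IsTestFn (φ : SchwartzMap E ℂ) : Prop := HasCompactSupport ⇑φ

/-- Translation bounded as a tempered distribution. -/
def TransBddTD (T : SchwartzMap E ℂ →L[ℂ] ℂ) : Prop :=
  ∀ ψ : SchwartzMap E ℂ, IsBddFun (convTD T ψ)

/-- Translation bounded as a distribution. -/
def TransBddD (T : SchwartzMap E ℂ →L[ℂ] ℂ) : Prop :=
  ∀ ψ : SchwartzMap E ℂ, IsTestFn ψ → IsBddFun (convTD T ψ)

/-- Strongly almost periodic as a tempered distribution. -/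
def SAPTD (T : SchwartzMap E ℂ →L[ℂ] ℂ) : Prop :=
  ∀ ψ : SchwartzMap E ℂ, IsBohrAP (convTD T ψ)

/-- Strongly almost periodic as a distribution. -/
def SAPD (T : SchwartzMap E ℂ →L[ℂ] ℂ) : Prop :=
  ∀ ψ : SchwartzMap E ℂ, IsTestFn ψ → IsBohrAP (convTD T ψ)

/-- The distributional Fourier transform, `T̂(φ) = T(φ̂)`, with the convention
`φ̂(ξ) = ∫ e^{-2πi⟨x,ξ⟩} φ(x) dx`. -/
def fourierTD (T : SchwartzMap E ℂ →L[ℂ] ℂ) : SchwartzMap E ℂ →L[ℂ] ℂ :=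
  T.comp (SchwartzMap.fourierTransformCLM ℂ)

/-- A complex Radon measure, encoded by its total variation measure together with a
unimodular density (polar decomposition). -/
structure CMeasure (E : Type*) [TopologicalSpace E] [MeasurableSpace E] where
  /-- the total variation measure -/
  tv : Measure E
  locFin : IsLocallyFiniteMeasure tv
  /-- the unimodular density -/
  density : E → ℂ
  density_meas : Measurable density
  density_norm : ∀ᵐ x ∂tv, ‖density x‖ = 1

namespace CMeasure

/-- Pairing of a complex measure with a function: `μ(φ) = ∫ φ dμ`. -/
def pairing (μ : CMeasure E) (φ : E → ℂ) : ℂ := ∫ x, φ x * μ.density x ∂μ.tv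

/-- The complex measure agrees with the tempered distribution `T` on all smooth
compactly supported test functions; i.e. `μ` is a tempered measure identified with `T`. -/
def Agrees (μ : CMeasure E) (T : SchwartzMap E ℂ →L[ℂ] ℂ) : Prop :=
  ∀ φ : SchwartzMap E ℂ, IsTestFn φ → T φ = μ.pairing ⇑φ

/-- A tempered measure is one that extends to a tempered distribution. -/
def IsTempered (μ : CMeasure E) : Prop := ∃ T, μ.Agrees T

/-- Pure point measure: concentrated on a countable set. -/
def IsPurePoint (μ : CMeasure E) : Prop := ∃ S : Set E, S.Countable ∧ μ.tv Sᶜ = 0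

/-- Convolution of a complex measure with a function: `(μ * φ)(x) = ∫ φ(x - y) dμ(y)`. -/
def convM (μ : CMeasure E) (φ : E → ℂ) : E → ℂ :=
  fun x => ∫ y, φ (x - y) * μ.density y ∂μ.tv

/-- Translation bounded as a measure. -/
def TransBddM (μ : CMeasure E) : Prop :=
  ∀ φ : E → ℂ, Continuous φ → HasCompactSupport φ → IsBddFun (μ.convM φ)

/-- Strongly almost periodic as a measure. -/
def SAPM (μ : CMeasure E) : Prop :=
  ∀ φ : E → ℂ, Continuous φ → HasCompactSupport φ → IsBohrAP (μ.convM φ)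

/-- Strongly tempered measure: the total variation has polynomial growth,
equivalently `|μ|` is a tempered (slowly increasing) measure. -/
def IsStronglyTempered (μ : CMeasure E) : Prop :=
  ∃ C a : ℝ, ∀ r : ℝ, 1 ≤ r → μ.tv (Metric.closedBall 0 r) ≤ ENNReal.ofReal (C * r ^ a)

/-- The atom of a complex measure at a point: `μ({x})`. -/
def atom (μ : CMeasure E) (x : E) : ℂ := (μ.tv {x}).toReal • μ.density x

/-- The measure is concentrated on a locally finite set. -/
def LocallyFiniteSupport (μ : CMeasure E) : Prop :=
  ∃ S : Set E, (∀ K : Set E, IsCompact K → (S ∩ K).Finite) ∧ μ.tv Sᶜ = 0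

end CMeasure

end Preamble

section Mean

variable {d : ℕ}

/-- The centred cube `[-R, R]^d`. -/
def cube (d : ℕ) (R : ℝ) : Set (EuclideanSpace ℝ (Fin d)) :=
  {x : EuclideanSpace ℝ (Fin d) | ∀ i, |x i| ≤ R}

/-- `g` has mean `m`: the averages over the cubes `[-R, R]^d` converge to `m`. -/
def HasMean (g : EuclideanSpace ℝ (Fin d) → ℂ) (m : ℂ) : Prop :=
  Filter.Tendsto (fun R : ℝ => ((2 * R) ^ d)⁻¹ • ∫ x in cube d R, g x)
    Filter.atTop (nhds m)

/-- The character `x ↦ e^{-2πi⟨x,k⟩}`. -/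
def eChar (k x : EuclideanSpace ℝ (Fin d)) : ℂ :=
  Complex.exp (((-(2 * Real.pi * (inner ℝ x k : ℝ)) : ℝ) : ℂ) * Complex.I)

end Mean


section AvgLemmas
variable {d : ℕ}

lemma cube_eq_preimage (R : ℝ) :
    cube d R = (WithLp.ofLp) ⁻¹' (Set.Icc (fun _ : Fin d => -R) (fun _ => R)) := by
  ext x
  simp only [cube, Set.mem_ofPred_eq, Set.mem_preimage, Set.mem_Icc, Pi.le_def, abs_le]
  exact forall_and

lemma isClosed_cube (R : ℝ) : IsClosed (cube d R) := by
  rw [cube_eq_preimage]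
  exact isClosed_Icc.preimage (PiLp.continuous_ofLp 2 _)

lemma measurableSet_cube (R : ℝ) : MeasurableSet (cube d R) := (isClosed_cube R).measurableSet

lemma volume_cube (R : ℝ) (hR : 0 ≤ R) : volume (cube d R) = ENNReal.ofReal ((2 * R) ^ d) := by
  rw [cube_eq_preimage, (PiLp.volume_preserving_ofLp (Fin d)).measure_preimage
    measurableSet_Icc.nullMeasurableSet, Real.volume_Icc_pi]
  simp only [Finset.prod_const, Finset.card_univ, Fintype.card_fin]
  rw [← ENNReal.ofReal_pow (by linarith)]
  congr 2; ring

lemma volume_real_cube (R : ℝ) (hR : 0 ≤ R) : volume.real (cube d R) = (2 * R) ^ d := by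
  rw [Measure.real, volume_cube R hR, ENNReal.toReal_ofReal (by positivity)]

lemma volume_cube_lt_top (R : ℝ) : volume (cube d R) < ⊤ := by
  refine (measure_mono (t := cube d |R|) ?_).trans_lt ?_
  · intro x hx i
    exact (hx i).trans (le_abs_self R)
  · rw [volume_cube _ (abs_nonneg R)]; exact ENNReal.ofReal_lt_top

lemma coord_le_norm (x : EuclideanSpace ℝ (Fin d)) (i : Fin d) : |x i| ≤ ‖x‖ := by
  simpa using PiLp.norm_apply_le x i

lemma cube_bounded (R : ℝ) : ∃ B : ℝ, 0 < B ∧ ∀ x ∈ cube d R, ‖x‖ ≤ B := by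
  refine ⟨√(d * R ^ 2) + 1, by positivity, fun x hx => ?_⟩
  rw [EuclideanSpace.norm_eq]
  refine le_trans (Real.sqrt_le_sqrt (y := d * R ^ 2) ?_) (by linarith)
  calc ∑ i, ‖x i‖ ^ 2 ≤ ∑ _i : Fin d, R ^ 2 := by
        refine Finset.sum_le_sum fun i _ => ?_
        have := hx i
        rw [Real.norm_eq_abs]
        exact pow_le_pow_left₀ (abs_nonneg _) this 2
    _ = d * R ^ 2 := by simp

lemma cube_mono {R S : ℝ} (h : R ≤ S) : cube d R ⊆ cube d S := fun _ hx i => (hx i).trans h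

lemma isCompact_cube (R : ℝ) : IsCompact (cube d R) := by
  obtain ⟨B, _, hB⟩ := cube_bounded (d := d) R
  refine Metric.isCompact_of_isClosed_isBounded (isClosed_cube R) ?_
  exact (Metric.isBounded_closedBall (x := 0) (r := B)).subset fun x hx => by
    simpa using hB x hx

/-- average over the translated cube -/
def avg (R : ℝ) (F : EuclideanSpace ℝ (Fin d) → ℂ) (t : EuclideanSpace ℝ (Fin d)) : ℂ :=
  ((2 * R) ^ d)⁻¹ • ∫ x in cube d R, F (x + t)

lemma integrableOn_cube {F : EuclideanSpace ℝ (Fin d) → ℂ} (hF : Continuous F) (R : ℝ) :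
    IntegrableOn F (cube d R) := hF.continuousOn.integrableOn_compact (isCompact_cube R)

lemma norm_avg_le {R : ℝ} (hR : 0 < R) {F : EuclideanSpace ℝ (Fin d) → ℂ} {t} {C : ℝ}
    (hC : ∀ x ∈ cube d R, ‖F (x + t)‖ ≤ C) : ‖avg R F t‖ ≤ C := by
  unfold avg
  rw [norm_smul]
  have h1 : ‖∫ x in cube d R, F (x + t)‖ ≤ C * volume.real (cube d R) :=
    norm_setIntegral_le_of_norm_le_const (volume_cube_lt_top R) hC
  rw [volume_real_cube R hR.le] at h1
  have h2 : (0:ℝ) < (2 * R) ^ d := by positivity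
  rw [norm_inv, Real.norm_of_nonneg h2.le, inv_mul_le_iff₀ h2]
  linarith

lemma avg_sub {R : ℝ} {F G : EuclideanSpace ℝ (Fin d) → ℂ} (hF : Continuous F)
    (hG : Continuous G) (t s) :
    avg R F t - avg R G s = ((2 * R) ^ d)⁻¹ • ∫ x in cube d R, (F (x + t) - G (x + s)) := by
  unfold avg
  rw [integral_sub, smul_sub]
  · exact integrableOn_cube (hF.comp (continuous_id.add continuous_const)) R
  · exact integrableOn_cube (hG.comp (continuous_id.add continuous_const)) R

lemma norm_avg_sub_avg_le {R : ℝ} (hR : 0 < R) {F G : EuclideanSpace ℝ (Fin d) → ℂ}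
    (hF : Continuous F) (hG : Continuous G) {t s} {C : ℝ}
    (hC : ∀ x ∈ cube d R, ‖F (x + t) - G (x + s)‖ ≤ C) : ‖avg R F t - avg R G s‖ ≤ C := by
  rw [avg_sub hF hG]
  have := norm_avg_le (F := fun x => F (x + t) - G (x + s)) (t := 0) hR (C := C)
    (by simpa using hC)
  simpa [avg] using this

/-- boundary defect -/
def kap (d : ℕ) (r R : ℝ) : ℝ := 2 * (((R + r) / R) ^ d - 1)

lemma kap_tendsto (r : ℝ) : Tendsto (fun R => kap d r R) atTop (𝓝 0) := by
  have h1 : Tendsto (fun R : ℝ => 1 + r / R) atTop (𝓝 (1 + 0)) :=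
    tendsto_const_nhds.add (tendsto_const_nhds.div_atTop tendsto_id)
  have h2 : Tendsto (fun R : ℝ => 2 * ((1 + r / R) ^ d - 1)) atTop (𝓝 (2 * ((1 + 0) ^ d - 1))) :=
    ((h1.pow d).sub_const 1).const_mul 2
  simp only [add_zero, one_pow, sub_self, mul_zero] at h2
  refine h2.congr' ?_
  filter_upwards [eventually_gt_atTop 0] with R hR
  simp only [kap]
  rw [add_div, div_self hR.ne']

lemma kap_nonneg {r R : ℝ} (hr : 0 ≤ r) (hR : 0 < R) : 0 ≤ kap d r R := by
  unfold kap
  have : 1 ≤ ((R + r) / R) ^ d := by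
    apply one_le_pow₀
    rw [le_div_iff₀ hR]; linarith
  linarith

lemma avg_shift {R r C : ℝ} (hR : 0 < R) (hr : 0 ≤ r) {F : EuclideanSpace ℝ (Fin d) → ℂ}
    (hF : Continuous F) (hC : ∀ x, ‖F x‖ ≤ C) (t y : EuclideanSpace ℝ (Fin d))
    (hy : ∀ i, |y i| ≤ r) : ‖avg R F (t + y) - avg R F t‖ ≤ C * kap d r R := by
  set H : EuclideanSpace ℝ (Fin d) → ℂ := fun x => F (x + t) with hH
  have hHc : Continuous H := hF.comp (continuous_id.add continuous_const)
  set A : Set (EuclideanSpace ℝ (Fin d)) := (fun x => x - y) ⁻¹' cube d R with hA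
  have hAm : MeasurableSet A := (measurableSet_cube R).preimage (measurable_id.sub_const y)
  have hAQ : A ⊆ cube d (R + r) := by
    intro x hx i
    have h1 := hx i
    have h2 := hy i
    simp only [PiLp.sub_apply] at h1
    calc |x i| = |(x i - y i) + y i| := by ring_nf
      _ ≤ |x i - y i| + |y i| := abs_add_le _ _
      _ ≤ R + r := add_le_add h1 h2
  have hBQ : cube d R ⊆ cube d (R + r) := cube_mono (by linarith)
  have hvA : volume A = volume (cube d R) := by
    simpa [hA, sub_eq_add_neg] using measure_preimage_add_right volume (-y) (cube d R)
  have h1 : ∫ x in cube d R, F (x + (t + y)) = ∫ x in A, H x := by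
    have hmp := measurePreserving_add_right (volume : Measure (EuclideanSpace ℝ (Fin d))) y
    have := hmp.setIntegral_preimage_emb (MeasurableEquiv.addRight y).measurableEmbedding H A
    rw [← this]
    have hs : (fun x => x + y) ⁻¹' A = cube d R := by
      ext x; simp [hA]
    rw [hs]
    simp only [hH]
    congr 1
    ext x
    congr 1
    abel
  have hintg := integrableOn_cube hHc (R + r)
  have key : ∀ B : Set (EuclideanSpace ℝ (Fin d)), MeasurableSet B → B ⊆ cube d (R + r) →
      volume B = volume (cube d R) →
      ‖(∫ x in cube d (R + r), H x) - ∫ x in B, H x‖ ≤ C * ((2 * (R + r)) ^ d - (2 * R) ^ d) := by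
    intro B hB hBs hv
    have hd : (∫ x in cube d (R + r), H x) - ∫ x in B, H x
        = ∫ x in cube d (R + r) \ B, H x := by
      rw [setIntegral_sdiff hB hintg hBs]
    rw [hd]
    have hle : ‖∫ x in cube d (R + r) \ B, H x‖ ≤ C * volume.real (cube d (R + r) \ B) :=
      norm_setIntegral_le_of_norm_le_const
        ((measure_mono Set.sdiff_subset).trans_lt (volume_cube_lt_top (R + r)))
        (fun x _ => hC _)
    have hv2 : volume.real (cube d (R + r) \ B) = (2 * (R + r)) ^ d - (2 * R) ^ d := by
      rw [measureReal_sdiff hBs hB (volume_cube_lt_top _).ne, volume_real_cube _ (by linarith), Measure.real, hv,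
        ← Measure.real, volume_real_cube _ hR.le]
    rwa [hv2] at hle
  have kA := key A hAm hAQ hvA
  have kB := key (cube d R) (measurableSet_cube R) hBQ rfl
  have h2 : (0:ℝ) < (2 * R) ^ d := by positivity
  unfold avg
  rw [h1, ← smul_sub, norm_smul, norm_inv, Real.norm_of_nonneg h2.le, inv_mul_le_iff₀ h2]
  have e : (2 * R) ^ d * (C * kap d r R) = 2 * (C * ((2 * (R + r)) ^ d - (2 * R) ^ d)) := by
    have : (2 * R) ^ d * ((R + r) / R) ^ d = (2 * (R + r)) ^ d := by
      rw [← mul_pow]; congr 1; field_simp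
    unfold kap
    rw [← this]; ring
  rw [e]
  calc ‖(∫ x in A, H x) - ∫ x in cube d R, H x‖
      = ‖((∫ x in cube d (R + r), H x) - ∫ x in cube d R, H x)
        - ((∫ x in cube d (R + r), H x) - ∫ x in A, H x)‖ := by congr 1; ring
    _ ≤ _ := norm_sub_le _ _
    _ ≤ _ := by linarith

end AvgLemmas

section GAPsec
variable {d : ℕ}

/-- working notion of almost periodicity: bounded, uniformly continuous, totally bounded orbit -/
structure GAP (f : EuclideanSpace ℝ (Fin d) → ℂ) : Prop where
  uc : UniformContinuous f
  bdd : ∃ C : ℝ, ∀ x, ‖f x‖ ≤ C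
  tb : ∀ ε : ℝ, 0 < ε → ∃ s : Finset (EuclideanSpace ℝ (Fin d)), ∀ t, ∃ i ∈ s, ∀ x,
    ‖f (x + t) - f (x + i)‖ < ε

lemma GAP.of_bohr {f : EuclideanSpace ℝ (Fin d) → ℂ} (h : IsBohrAP f) : GAP f := by
  refine ⟨h.1, h.2.1, fun ε hε => ?_⟩
  obtain ⟨r, hr⟩ := h.2.2 (ε / 2) (by linarith)
  obtain ⟨δ, hδ, hu⟩ := Metric.uniformContinuous_iff.1 h.1 (ε / 2) (by linarith)
  obtain ⟨s, -, hsf, hs⟩ := (isCompact_closedBall (0 : EuclideanSpace ℝ (Fin d)) r).finite_cover_balls hδ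
  refine ⟨hsf.toFinset, fun t => ?_⟩
  obtain ⟨a, ha, hta⟩ := hr t
  have hm : t - a ∈ closedBall (0 : EuclideanSpace ℝ (Fin d)) r := by
    rw [mem_closedBall, dist_zero_right, ← dist_eq_norm]; exact hta
  have := hs hm
  simp only [Set.mem_iUnion] at this
  obtain ⟨i, his, hi⟩ := this
  refine ⟨i, by simpa using his, fun x => ?_⟩
  have h1 := ha (x + t)
  have h2 := hu (a := x + t - a) (b := x + i) (by
    rw [mem_ball] at hi
    rw [dist_eq_norm] at hi ⊢
    convert hi using 2; abel)
  rw [dist_eq_norm] at h2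
  calc ‖f (x + t) - f (x + i)‖ = ‖(f (x + t - a) - f (x + i)) - (f (x + t - a) - f (x + t))‖ := by
        congr 1; ring
    _ ≤ ‖f (x + t - a) - f (x + i)‖ + ‖f (x + t - a) - f (x + t)‖ := norm_sub_le _ _
    _ < ε := by linarith

lemma GAP.add {f g : EuclideanSpace ℝ (Fin d) → ℂ} (hf : GAP f) (hg : GAP g) :
    GAP (fun x => f x + g x) := by
  classical
  refine ⟨hf.uc.add hg.uc, ?_, fun ε hε => ?_⟩
  · obtain ⟨C, hC⟩ := hf.bdd
    obtain ⟨D, hD⟩ := hg.bdd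
    exact ⟨C + D, fun x => (norm_add_le _ _).trans (add_le_add (hC x) (hD x))⟩
  obtain ⟨s, hs⟩ := hf.tb (ε / 4) (by linarith)
  obtain ⟨s', hs'⟩ := hg.tb (ε / 4) (by linarith)
  let Q : EuclideanSpace ℝ (Fin d) × EuclideanSpace ℝ (Fin d) → EuclideanSpace ℝ (Fin d) → Prop :=
    fun p t => (∀ x, ‖f (x + t) - f (x + p.1)‖ < ε / 4) ∧ (∀ x, ‖g (x + t) - g (x + p.2)‖ < ε / 4)
  let rep : EuclideanSpace ℝ (Fin d) × EuclideanSpace ℝ (Fin d) → EuclideanSpace ℝ (Fin d) :=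
    fun p => if h : ∃ t, Q p t then h.choose else 0
  refine ⟨(s ×ˢ s').image rep, fun t => ?_⟩
  obtain ⟨i, hi, hit⟩ := hs t
  obtain ⟨j, hj, hjt⟩ := hs' t
  have hQ : Q (i, j) t := ⟨hit, hjt⟩
  have hex : ∃ t, Q (i, j) t := ⟨t, hQ⟩
  have hr : Q (i, j) (rep (i, j)) := by
    simp only [rep, dif_pos hex]; exact hex.choose_spec
  refine ⟨rep (i, j), Finset.mem_image_of_mem _ (Finset.mk_mem_product hi hj), fun x => ?_⟩
  have a1 := hQ.1 x
  have a2 := hQ.2 x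
  have a3 := hr.1 x
  have a4 := hr.2 x
  calc ‖f (x + t) + g (x + t) - (f (x + rep (i, j)) + g (x + rep (i, j)))‖
      = ‖((f (x + t) - f (x + i)) + (g (x + t) - g (x + j))) -
        ((f (x + rep (i, j)) - f (x + i)) + (g (x + rep (i, j)) - g (x + j)))‖ := by congr 1; ring
    _ ≤ (‖f (x + t) - f (x + i)‖ + ‖g (x + t) - g (x + j)‖) +
        (‖f (x + rep (i, j)) - f (x + i)‖ + ‖g (x + rep (i, j)) - g (x + j)‖) :=
        (norm_sub_le _ _).trans (add_le_add (norm_add_le _ _) (norm_add_le _ _))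
    _ < ε := by linarith

lemma GAP.const_mul {f : EuclideanSpace ℝ (Fin d) → ℂ} (hf : GAP f) (c : ℂ) :
    GAP (fun x => c * f x) := by
  refine ⟨?_, ?_, fun ε hε => ?_⟩
  · exact hf.uc.const_smul c
  · obtain ⟨C, hC⟩ := hf.bdd
    exact ⟨‖c‖ * C, fun x => by rw [norm_mul]; exact mul_le_mul_of_nonneg_left (hC x) (norm_nonneg _)⟩
  obtain ⟨s, hs⟩ := hf.tb (ε / (‖c‖ + 1)) (by positivity)
  refine ⟨s, fun t => ?_⟩
  obtain ⟨i, hi, hit⟩ := hs t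
  refine ⟨i, hi, fun x => ?_⟩
  rw [← mul_sub, norm_mul]
  have h1 := hit x
  rw [lt_div_iff₀ (by positivity)] at h1
  nlinarith [norm_nonneg (f (x + t) - f (x + i)), norm_nonneg c]

lemma GAP.of_approx {f : EuclideanSpace ℝ (Fin d) → ℂ}
    (h : ∀ ε : ℝ, 0 < ε → ∃ g, GAP g ∧ ∀ x, ‖f x - g x‖ ≤ ε) : GAP f := by
  refine ⟨?_, ?_, fun ε hε => ?_⟩
  · rw [Metric.uniformContinuous_iff]
    intro ε hε
    obtain ⟨g, hg, hfg⟩ := h (ε / 4) (by linarith)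
    obtain ⟨δ, hδ, hu⟩ := Metric.uniformContinuous_iff.1 hg.uc (ε / 4) (by linarith)
    refine ⟨δ, hδ, fun {x y} hxy => ?_⟩
    have h1 := hu hxy
    rw [dist_eq_norm] at h1 ⊢
    calc ‖f x - f y‖ = ‖(f x - g x) + (g x - g y) - (f y - g y)‖ := by congr 1; ring
      _ ≤ ‖f x - g x‖ + ‖g x - g y‖ + ‖f y - g y‖ :=
        (norm_sub_le _ _).trans (add_le_add (norm_add_le _ _) le_rfl)
      _ < ε := by linarith [hfg x, hfg y]
  · obtain ⟨g, hg, hfg⟩ := h 1 one_pos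
    obtain ⟨C, hC⟩ := hg.bdd
    refine ⟨1 + C, fun x => ?_⟩
    calc ‖f x‖ = ‖(f x - g x) + g x‖ := by congr 1; ring
      _ ≤ _ := (norm_add_le _ _).trans (add_le_add (hfg x) (hC x))
  · obtain ⟨g, hg, hfg⟩ := h (ε / 4) (by linarith)
    obtain ⟨s, hs⟩ := hg.tb (ε / 4) (by linarith)
    refine ⟨s, fun t => ?_⟩
    obtain ⟨i, hi, hit⟩ := hs t
    refine ⟨i, hi, fun x => ?_⟩
    calc ‖f (x + t) - f (x + i)‖ = ‖(f (x + t) - g (x + t)) + (g (x + t) - g (x + i))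
          - (f (x + i) - g (x + i))‖ := by congr 1; ring
      _ ≤ ‖f (x + t) - g (x + t)‖ + ‖g (x + t) - g (x + i)‖ + ‖f (x + i) - g (x + i)‖ :=
        (norm_sub_le _ _).trans (add_le_add (norm_add_le _ _) le_rfl)
      _ < ε := by linarith [hfg (x + t), hfg (x + i), hit x]

lemma eChar_add (k x y : EuclideanSpace ℝ (Fin d)) : eChar k (x + y) = eChar k x * eChar k y := by
  unfold eChar
  rw [← Complex.exp_add, inner_add_left]
  congr 1; push_cast; ring

lemma eChar_add_left (k l x : EuclideanSpace ℝ (Fin d)) :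
    eChar (k + l) x = eChar k x * eChar l x := by
  unfold eChar
  rw [← Complex.exp_add, inner_add_right]
  congr 1; push_cast; ring

@[simp] lemma norm_eChar (k x : EuclideanSpace ℝ (Fin d)) : ‖eChar k x‖ = 1 := by
  unfold eChar; exact Complex.norm_exp_ofReal_mul_I _

@[simp] lemma eChar_zero (k : EuclideanSpace ℝ (Fin d)) : eChar k 0 = 1 := by
  simp [eChar]

@[simp] lemma eChar_zero_left (x : EuclideanSpace ℝ (Fin d)) : eChar 0 x = 1 := by
  simp [eChar]

lemma continuous_eChar (k : EuclideanSpace ℝ (Fin d)) : Continuous (eChar k) := by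
  unfold eChar; fun_prop

lemma continuous_eChar_left (x : EuclideanSpace ℝ (Fin d)) : Continuous (fun k => eChar k x) := by
  unfold eChar; fun_prop

lemma norm_eChar_sub_le (k l x : EuclideanSpace ℝ (Fin d)) :
    ‖eChar k x - eChar l x‖ ≤ 2 * Real.pi * ‖x‖ * ‖k - l‖ := by
  have h1 : eChar k x = eChar (k - l) x * eChar l x := by rw [← eChar_add_left]; congr 1; abel
  rw [h1, ← sub_one_mul, norm_mul, norm_eChar, mul_one]
  unfold eChar
  have := Real.norm_exp_I_mul_ofReal_sub_one_le (x := -(2 * Real.pi * inner ℝ x (k - l)))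
  rw [mul_comm] at this
  refine this.trans ?_
  rw [norm_neg, norm_mul, Real.norm_of_nonneg (by positivity), mul_assoc (2 * Real.pi) ‖x‖]
  refine mul_le_mul_of_nonneg_left ?_ (by positivity : (0:ℝ) ≤ 2 * Real.pi)
  exact norm_inner_le_norm x (k - l)

lemma eChar_symm (k x : EuclideanSpace ℝ (Fin d)) : eChar k x = eChar x k := by
  unfold eChar; rw [real_inner_comm]

lemma GAP.eChar (k : EuclideanSpace ℝ (Fin d)) : GAP (eChar k) := by
  have hnorm : ∀ x y, ‖_root_.eChar k x - _root_.eChar k y‖ ≤ 2 * Real.pi * ‖k‖ * ‖x - y‖ := by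
    intro x y
    rw [eChar_symm k x, eChar_symm k y]; exact norm_eChar_sub_le x y k
  refine ⟨?_, ⟨1, fun x => by simp⟩, fun ε hε => ?_⟩
  · refine (LipschitzWith.of_dist_le_mul (K := ⟨2 * Real.pi * ‖k‖, by positivity⟩) ?_).uniformContinuous
    intro x y
    rw [dist_eq_norm, dist_eq_norm]; exact hnorm x y
  · have htb : TotallyBounded (Set.range (_root_.eChar k)) := by
      refine TotallyBounded.subset (s₂ := closedBall 0 1) ?_ (isCompact_closedBall 0 1).totallyBounded
      rintro _ ⟨x, rfl⟩
      simp
    obtain ⟨t, hts, htf, htc⟩ := Metric.finite_approx_of_totallyBounded htb ε hε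
    have hts' : ∀ c ∈ t, ∃ x, _root_.eChar k x = c := fun c hc => hts hc
    choose! g hg using hts'
    classical
    refine ⟨htf.toFinset.image g, fun t' => ?_⟩
    have := htc ⟨t', rfl⟩
    simp only [Set.mem_iUnion] at this
    obtain ⟨c, hc, hc2⟩ := this
    refine ⟨g c, Finset.mem_image_of_mem _ (by simpa using hc), fun x => ?_⟩
    rw [eChar_add, eChar_add, ← mul_sub, norm_mul, norm_eChar, one_mul, hg c hc]
    rwa [mem_ball, dist_eq_norm] at hc2

lemma GAP.zero : GAP (fun _ : EuclideanSpace ℝ (Fin d) => (0:ℂ)) := by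
  simpa using (GAP.eChar (0 : EuclideanSpace ℝ (Fin d))).const_mul 0

lemma GAP.sum {ι : Type*} (s : Finset ι) (f : ι → EuclideanSpace ℝ (Fin d) → ℂ)
    (h : ∀ i ∈ s, GAP (f i)) : GAP (fun x => ∑ i ∈ s, f i x) := by
  classical
  induction s using Finset.induction_on with
  | empty => simpa using GAP.zero
  | insert a s ha ih =>
    simp only [Finset.sum_insert ha]
    exact (h a (Finset.mem_insert_self _ _)).add
      (ih fun i hi => h i (Finset.mem_insert_of_mem hi))

end GAPsec

section UnifAvg
variable {d : ℕ}

lemma hasMean_iff_avg (g : EuclideanSpace ℝ (Fin d) → ℂ) (m : ℂ) :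
    HasMean g m ↔ Tendsto (fun R => avg R g 0) atTop (𝓝 m) := by
  simp [HasMean, avg]

lemma avg_const {R : ℝ} (hR : 0 < R) (c : ℂ) (t : EuclideanSpace ℝ (Fin d)) :
    avg R (fun _ => c) t = c := by
  unfold avg
  rw [setIntegral_const, volume_real_cube R hR.le, smul_smul, inv_mul_cancel₀ (by positivity),
    one_smul]

lemma continuous_avg (R : ℝ) {F : EuclideanSpace ℝ (Fin d) → ℂ} (hF : Continuous F) :
    Continuous (avg R F) := by
  have h : Continuous (fun t : EuclideanSpace ℝ (Fin d) => ∫ x in cube d R, F (x + t)) :=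
    continuous_parametric_integral_of_continuous (X := EuclideanSpace ℝ (Fin d))
      (f := fun t x => F (x + t))
      (hF.comp (continuous_snd.add continuous_fst)) (isCompact_cube R)
  exact h.const_smul (((2 * R) ^ d)⁻¹ : ℝ)

lemma avg_comm (R L : ℝ) {F : EuclideanSpace ℝ (Fin d) → ℂ} (hF : Continuous F)
    (t : EuclideanSpace ℝ (Fin d)) : avg R (avg L F) t = avg L (avg R F) t := by
  unfold avg
  simp only [integral_smul]
  rw [smul_comm]
  congr 2
  rw [integral_integral_swap]
  · congr 1; ext x; congr 1; ext y; congr 1; abel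
  · have hc : Continuous (Function.uncurry fun (x y : EuclideanSpace ℝ (Fin d)) =>
      F (y + (x + t))) := by fun_prop
    have : IntegrableOn (Function.uncurry fun (x y : EuclideanSpace ℝ (Fin d)) =>
      F (y + (x + t))) (cube d R ×ˢ cube d L) (volume.prod volume) :=
      hc.continuousOn.integrableOn_compact ((isCompact_cube R).prod (isCompact_cube L))
    rwa [IntegrableOn, ← Measure.prod_restrict] at this

lemma avg_avg_le {R L C ε : ℝ} (hR : 0 < R) (hL : 0 < L) {F : EuclideanSpace ℝ (Fin d) → ℂ}
    (hF : Continuous F) (hC : ∀ x, ‖F x‖ ≤ C) (h : ∀ t, ‖avg R F t‖ ≤ ε)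
    (t : EuclideanSpace ℝ (Fin d)) : ‖avg L F t‖ ≤ ε + C * kap d R L := by
  have h1 : ‖avg R (avg L F) t - avg R (fun _ => avg L F t) t‖ ≤ C * kap d R L := by
    refine norm_avg_sub_avg_le hR (continuous_avg L hF) continuous_const fun x hx => ?_
    rw [add_comm]
    exact avg_shift hL hR.le hF hC t x hx
  rw [avg_const hR, avg_comm R L hF] at h1
  have h2 : ‖avg L (avg R F) t‖ ≤ ε := norm_avg_le hL fun x _ => h _
  calc ‖avg L F t‖ = ‖avg L (avg R F) t - (avg L (avg R F) t - avg L F t)‖ := by congr 1; ring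
    _ ≤ _ := (norm_sub_le _ _).trans (add_le_add h2 h1)

lemma HasMean.avg_tendsto {g : EuclideanSpace ℝ (Fin d) → ℂ} {m : ℂ} (hg : HasMean g m)
    (hc : Continuous g) {C : ℝ} (hC : ∀ x, ‖g x‖ ≤ C) (t : EuclideanSpace ℝ (Fin d)) :
    Tendsto (fun R => avg R g t) atTop (𝓝 m) := by
  rw [hasMean_iff_avg] at hg
  have h1 : Tendsto (fun R => avg R g t - avg R g 0) atTop (𝓝 0) := by
    rw [tendsto_zero_iff_norm_tendsto_zero]
    refine squeeze_zero' (g := fun R => C * kap d ‖t‖ R) (Eventually.of_forall fun _ => norm_nonneg _) ?_ ?_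
    · filter_upwards [eventually_gt_atTop 0] with R hR
      have := avg_shift hR (norm_nonneg t) hc hC 0 t (coord_le_norm t)
      rwa [zero_add] at this
    · simpa using (kap_tendsto (d := d) ‖t‖).const_mul C
  simpa using h1.add hg

lemma norm_avg_eChar_mul (R : ℝ) (k : EuclideanSpace ℝ (Fin d)) (f : EuclideanSpace ℝ (Fin d) → ℂ)
    (t : EuclideanSpace ℝ (Fin d)) :
    ‖avg R (fun x => eChar k x * f x) t‖ = ‖avg R (fun x => eChar k x * f (x + t)) 0‖ := by
  have : avg R (fun x => eChar k x * f x) t = eChar k t * avg R (fun x => eChar k x * f (x + t)) 0 := by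
    unfold avg
    rw [mul_smul_comm, ← integral_const_mul]
    congr 2; ext x
    simp only [eChar_add, add_zero]; ring
  rw [this, norm_mul, norm_eChar, one_mul]

lemma GAP.unif_avg {f : EuclideanSpace ℝ (Fin d) → ℂ} (hf : GAP f) (k : EuclideanSpace ℝ (Fin d))
    (h0 : HasMean (fun x => _root_.eChar k x * f x) 0) {ε : ℝ} (hε : 0 < ε) :
    ∃ R : ℝ, 0 < R ∧ ∀ t, ‖avg R (fun x => _root_.eChar k x * f x) t‖ ≤ ε := by
  obtain ⟨C, hC⟩ := hf.bdd
  obtain ⟨s, hs⟩ := hf.tb (ε / 2) (by linarith)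
  have hfc := hf.uc.continuous
  have hec := continuous_eChar k
  have hc : Continuous (fun x => _root_.eChar k x * f x) := by fun_prop
  have hb : ∀ x, ‖_root_.eChar k x * f x‖ ≤ C := fun x => by simpa using hC x
  have hev : ∀ᶠ R in atTop, ∀ i ∈ s, ‖avg R (fun x => _root_.eChar k x * f x) i‖ ≤ ε / 2 := by
    rw [Filter.eventually_all_finset]
    intro i _
    have := (h0.avg_tendsto hc hb i).norm
    rw [norm_zero] at this
    exact (this.eventually (gt_mem_nhds (by linarith : (0:ℝ) < ε / 2))).mono fun _ h => h.le
  obtain ⟨R, hR, hRpos⟩ := (hev.and (eventually_gt_atTop 0)).exists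
  refine ⟨R, hRpos, fun t => ?_⟩
  obtain ⟨i, hi, hit⟩ := hs t
  have h1 := hR i hi
  rw [norm_avg_eChar_mul] at h1 ⊢
  have h2 : ‖avg R (fun x => _root_.eChar k x * f (x + t)) 0 - avg R (fun x => _root_.eChar k x * f (x + i)) 0‖
      ≤ ε / 2 := by
    refine norm_avg_sub_avg_le hRpos (by fun_prop) (by fun_prop) fun x _ => ?_
    rw [← mul_sub, norm_mul, norm_eChar, one_mul]
    exact (hit _).le
  have := norm_sub_norm_le (avg R (fun x => _root_.eChar k x * f (x + t)) 0)
    (avg R (fun x => _root_.eChar k x * f (x + i)) 0)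
  linarith

lemma GAP.unif_avg_loc {f : EuclideanSpace ℝ (Fin d) → ℂ} (hf : GAP f) (k : EuclideanSpace ℝ (Fin d))
    (h0 : HasMean (fun x => _root_.eChar k x * f x) 0) {ε : ℝ} (hε : 0 < ε) :
    ∃ δ : ℝ, 0 < δ ∧ ∃ L0 : ℝ, ∀ L, L0 ≤ L → ∀ l ∈ ball k δ, ∀ t,
      ‖avg L (fun x => _root_.eChar l x * f x) t‖ ≤ ε := by
  obtain ⟨C, hC⟩ := hf.bdd
  have hC0 : 0 ≤ C := (norm_nonneg _).trans (hC 0)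
  obtain ⟨R, hR, hRk⟩ := hf.unif_avg k h0 (ε := ε / 3) (by linarith)
  obtain ⟨B, hB, hBc⟩ := cube_bounded (d := d) R
  have hfc := hf.uc.continuous
  have hpi := Real.pi_pos
  refine ⟨ε / 3 / (2 * Real.pi * B * (C + 1)), by positivity, ?_⟩
  have hk : Tendsto (fun L => C * kap d R L) atTop (𝓝 0) := by
    simpa using (kap_tendsto (d := d) R).const_mul C
  obtain ⟨L0, hL0⟩ := eventually_atTop.1 ((hk.eventually (gt_mem_nhds
    (by linarith : (0:ℝ) < ε / 3))).and (eventually_gt_atTop 0))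
  refine ⟨L0, fun L hL l hl t => ?_⟩
  obtain ⟨hL1, hL2⟩ := hL0 L hL
  have hec := continuous_eChar k
  have hec' := continuous_eChar l
  have h1 : ∀ t, ‖avg R (fun x => _root_.eChar l x * f x) t‖ ≤ ε / 3 + ε / 3 := by
    intro t
    have h1 := hRk t
    rw [norm_avg_eChar_mul] at h1 ⊢
    have h2 : ‖avg R (fun x => _root_.eChar l x * f (x + t)) 0 - avg R (fun x => _root_.eChar k x * f (x + t)) 0‖
      ≤ ε / 3 := by
      refine norm_avg_sub_avg_le hR (by fun_prop) (by fun_prop) fun x hx => ?_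
      rw [add_zero, ← sub_mul, norm_mul]
      have a1 := norm_eChar_sub_le l k x
      have a2 := hBc x hx
      have a3 := hC (x + t)
      rw [mem_ball, dist_eq_norm, lt_div_iff₀ (by positivity)] at hl
      calc ‖_root_.eChar l x - _root_.eChar k x‖ * ‖f (x + t)‖
          ≤ (2 * Real.pi * B * ‖l - k‖) * (C + 1) := by
            refine mul_le_mul (a1.trans ?_) (by linarith) (norm_nonneg _) (by positivity)
            gcongr
        _ ≤ ε / 3 := by linarith
    have := norm_sub_norm_le (avg R (fun x => _root_.eChar l x * f (x + t)) 0)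
      (avg R (fun x => _root_.eChar k x * f (x + t)) 0)
    linarith
  have := avg_avg_le hR hL2 (F := fun x => _root_.eChar l x * f x) (by fun_prop)
    (C := C) (fun x => by simpa using hC x) h1 t
  linarith

lemma eChar_half (k : EuclideanSpace ℝ (Fin d)) (hk : k ≠ 0) :
    eChar k ((1 / (2 * ‖k‖ ^ 2)) • k) = -1 := by
  unfold eChar
  have : ‖k‖ ≠ 0 := norm_ne_zero_iff.2 hk
  rw [real_inner_smul_left, real_inner_self_eq_norm_sq]
  have e : -(2 * Real.pi * (1 / (2 * ‖k‖ ^ 2) * ‖k‖ ^ 2)) = -Real.pi := by field_simp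
  rw [e]
  push_cast
  rw [neg_mul, Complex.exp_neg, Complex.exp_pi_mul_I]
  norm_num

lemma norm_half (k : EuclideanSpace ℝ (Fin d)) (hk : k ≠ 0) :
    ‖(1 / (2 * ‖k‖ ^ 2)) • k‖ = 1 / (2 * ‖k‖) := by
  have : 0 < ‖k‖ := norm_pos_iff.2 hk
  rw [norm_smul, Real.norm_of_nonneg (by positivity)]
  field_simp

lemma avg_half_bound {f : EuclideanSpace ℝ (Fin d) → ℂ} (hfc : Continuous f) {C : ℝ}
    (hC : ∀ x, ‖f x‖ ≤ C)
    (k : EuclideanSpace ℝ (Fin d)) (hk : k ≠ 0) {η : ℝ}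
    (hη : ∀ x, ‖f x - f (x + (1 / (2 * ‖k‖ ^ 2)) • k)‖ ≤ η) {L : ℝ} (hL : 0 < L)
    (t : EuclideanSpace ℝ (Fin d)) :
    2 * ‖avg L (fun x => eChar k x * f x) t‖ ≤ η + C * kap d (1 / (2 * ‖k‖)) L := by
  set v := (1 / (2 * ‖k‖ ^ 2)) • k with hv
  have hec := continuous_eChar k
  have hkp : 0 < ‖k‖ := norm_pos_iff.2 hk
  have h1 := avg_shift hL (r := 1 / (2 * ‖k‖)) (by positivity) (F := fun x => eChar k x * f x)
    (by fun_prop) (C := C) (fun x => by simpa using hC x) t v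
    (fun i => (coord_le_norm v i).trans (norm_half k hk).le)
  have h2 : ‖avg L (fun x => eChar k x * f x) t - avg L (fun x => - (eChar k x * f x)) (t + v)‖ ≤ η := by
    refine norm_avg_sub_avg_le hL (by fun_prop) (by fun_prop) fun x _ => ?_
    have e : eChar k (x + (t + v)) = - eChar k (x + t) := by
      rw [← add_assoc, eChar_add, eChar_half k hk]; ring
    rw [e]
    have : eChar k (x + t) * f (x + t) - -(-eChar k (x + t) * f (x + (t + v)))
      = eChar k (x + t) * (f (x + t) - f (x + t + v)) := by rw [add_assoc]; ring
    rw [this, norm_mul, norm_eChar, one_mul]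
    exact hη _
  have h3 : avg L (fun x => - (eChar k x * f x)) (t + v) = - avg L (fun x => eChar k x * f x) (t + v) := by
    unfold avg; rw [integral_neg, smul_neg]
  rw [h3] at h2
  set A := avg L (fun x => eChar k x * f x) t
  set B := avg L (fun x => eChar k x * f x) (t + v)
  calc 2 * ‖A‖ = ‖(A - -B) - (B - A)‖ := by
        rw [show (A - -B) - (B - A) = 2 * A by ring, norm_mul]; simp
    _ ≤ _ := (norm_sub_le _ _).trans (add_le_add h2 h1)

lemma kap_mono {r s R : ℝ} (hr : 0 ≤ r) (h : r ≤ s) (hR : 0 < R) : kap d r R ≤ kap d s R := by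
  unfold kap
  have : ((R + r) / R) ^ d ≤ ((R + s) / R) ^ d := by gcongr
  linarith

lemma GAP.unif_avg_all {f : EuclideanSpace ℝ (Fin d) → ℂ} (hf : GAP f)
    (h0 : ∀ k, HasMean (fun x => _root_.eChar k x * f x) 0) {ε : ℝ} (hε : 0 < ε) :
    ∃ L0 : ℝ, ∀ L, L0 ≤ L → ∀ k t, ‖avg L (fun x => _root_.eChar k x * f x) t‖ ≤ ε := by
  obtain ⟨C, hC⟩ := hf.bdd
  have hC0 : 0 ≤ C := (norm_nonneg _).trans (hC 0)
  obtain ⟨δ, hδ, hu⟩ := Metric.uniformContinuous_iff.1 hf.uc ε hε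
  -- large frequencies
  set N : ℝ := 1 / δ + 1 with hN
  have hNp : 0 < N := by positivity
  have hk : Tendsto (fun L => C * kap d 1 L) atTop (𝓝 0) := by
    simpa using (kap_tendsto (d := d) 1).const_mul C
  obtain ⟨L1, hL1⟩ := eventually_atTop.1 ((hk.eventually (gt_mem_nhds hε)).and (eventually_gt_atTop 0))
  choose δ' hδ' L' hL' using fun k => hf.unif_avg_loc k (h0 k) hε
  obtain ⟨s, hs⟩ := (isCompact_closedBall (0 : EuclideanSpace ℝ (Fin d)) N).elim_nhds_subcover
    (fun k => ball k (δ' k)) (fun k _ => ball_mem_nhds k (hδ' k))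
  obtain ⟨L2, hL2⟩ := (s.image L').bddAbove
  refine ⟨max L1 L2, fun L hL k t => ?_⟩
  by_cases hkN : ‖k‖ ≤ N
  · have := hs.2 (show k ∈ closedBall 0 N by simpa using hkN)
    simp only [Set.mem_iUnion] at this
    obtain ⟨i, hi, hik⟩ := this
    exact hL' i L ((hL2 (by simpa using ⟨i, hi, rfl⟩)).trans ((le_max_right _ _).trans hL)) k hik t
  · push Not at hkN
    obtain ⟨a1, a2⟩ := hL1 L ((le_max_left _ _).trans hL)
    have hkp : 0 < ‖k‖ := hNp.trans hkN
    have hk0 : k ≠ 0 := norm_pos_iff.1 hkp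
    have h1N : (1:ℝ) ≤ ‖k‖ := by
      have : 0 < 1 / δ := by positivity
      linarith
    have hsm : 1 / (2 * ‖k‖) < δ := by
      rw [div_lt_iff₀ (by positivity)]
      have : 1 / δ < ‖k‖ := by linarith
      rw [div_lt_iff₀ hδ] at this
      nlinarith
    have := avg_half_bound hf.uc.continuous hC k hk0 (η := ε) (fun x => by
      rw [← dist_eq_norm]
      refine (hu ?_).le
      rw [dist_eq_norm, sub_add_cancel_left, norm_neg, norm_half k hk0]
      exact hsm) a2 t
    have h5 : kap d (1 / (2 * ‖k‖)) L ≤ kap d 1 L := by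
      refine kap_mono (by positivity) ?_ a2
      rw [div_le_one (by positivity)]; linarith
    have := mul_le_mul_of_nonneg_left h5 hC0
    linarith

end UnifAvg

section Planch
open scoped FourierTransform ContDiff
variable {d : ℕ}

lemma fourier_smul_flip {w g : EuclideanSpace ℝ (Fin d) → ℂ} (hw : Integrable w) (hg : Integrable g) :
    ∫ ξ, 𝓕 g ξ * w ξ = ∫ x, g x * 𝓕 w x := by
  simpa using! (VectorFourier.integral_fourierIntegral_smul_eq_flip
      (L := innerₗ (EuclideanSpace ℝ (Fin d)))
      Real.continuous_fourierChar continuous_inner hg hw)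

lemma planch {w : EuclideanSpace ℝ (Fin d) → ℂ} (hw : Integrable w) (hw2 : MemLp w 2) :
    MemLp (𝓕 w) 2 ∧ ∫ x, ‖𝓕 w x‖ ^ 2 = ∫ x, ‖w x‖ ^ 2 := by
  set W : Lp ℂ 2 (volume : Measure (EuclideanSpace ℝ (Fin d))) := hw2.toLp w with hW
  have hcont : Continuous (𝓕 w) := VectorFourier.fourierIntegral_continuous
    Real.continuous_fourierChar (by exact continuous_inner) hw
  have hae : ∀ᵐ x, 𝓕 w x = (𝓕 W : Lp ℂ 2 (volume : Measure (EuclideanSpace ℝ (Fin d)))) x := by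
    refine ae_eq_of_integral_contDiff_smul_eq hcont.locallyIntegrable
      ((Lp.memLp (𝓕 W)).locallyIntegrable (by norm_num)) fun g hg hgs => ?_
    have hgs' : HasCompactSupport (fun x => (g x : ℂ)) := hgs.comp_left Complex.ofReal_zero
    have hg' : ContDiff ℝ ∞ (fun x => (g x : ℂ)) := Complex.ofRealCLM.contDiff.comp hg
    set G : 𝓢(EuclideanSpace ℝ (Fin d), ℂ) := hgs'.toSchwartzMap hg' with hG
    have hGg : ∀ x, G x = (g x : ℂ) := fun x => rfl
    have h1 := congrArg (fun D => D G) (Lp.fourier_toTemperedDistribution_eq W)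
    simp only [TemperedDistribution.fourier_apply, Lp.toTemperedDistribution_apply, smul_eq_mul] at h1
    have h2 := fourier_smul_flip hw G.integrable
    simp only [Complex.real_smul, ← hGg]
    rw [← h1, ← h2, ← SchwartzMap.fourier_coe]
    refine integral_congr_ae ?_
    filter_upwards [hw2.coeFn_toLp] with x hx
    rw [hx]
  have hm : MemLp (𝓕 w) 2 := (memLp_congr_ae hae).2 (Lp.memLp (𝓕 W))
  refine ⟨hm, ?_⟩
  have hn : ∀ V : Lp ℂ 2 (volume : Measure (EuclideanSpace ℝ (Fin d))), ∫ x, ‖V x‖ ^ 2 = ‖V‖ ^ 2 := by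
    intro V
    have := L2.inner_def (𝕜 := ℂ) V V
    rw [inner_self_eq_norm_sq_to_K] at this
    have h3 : ∀ x, inner ℂ (V x) (V x) = ((‖V x‖ ^ 2 : ℝ) : ℂ) := fun x => by
      rw [inner_self_eq_norm_sq_to_K]; norm_cast
    simp only [h3] at this
    rw [integral_complex_ofReal] at this
    apply Complex.ofReal_injective
    rw [← this]; push_cast; rfl
  calc ∫ x, ‖𝓕 w x‖ ^ 2 = ∫ x, ‖(𝓕 W : Lp ℂ 2 (volume : Measure (EuclideanSpace ℝ (Fin d)))) x‖ ^ 2 := by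
        refine integral_congr_ae ?_
        filter_upwards [hae] with x hx
        rw [hx]
    _ = ‖W‖ ^ 2 := by rw [hn, Lp.norm_fourier_eq]
    _ = ∫ x, ‖W x‖ ^ 2 := (hn W).symm
    _ = _ := by
        refine integral_congr_ae ?_
        filter_upwards [hw2.coeFn_toLp] with x hx
        rw [hx]

end Planch

section Uniq
open scoped FourierTransform ContDiff
open scoped Convolution
variable {d : ℕ}

/-- ε-periods -/
def perSet (f : EuclideanSpace ℝ (Fin d) → ℂ) (ε : ℝ) : Set (EuclideanSpace ℝ (Fin d)) :=
  {t | ∀ x, ‖f (x + t) - f x‖ ≤ ε}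

lemma isClosed_perSet {f : EuclideanSpace ℝ (Fin d) → ℂ} (hf : Continuous f) (ε : ℝ) :
    IsClosed (perSet f ε) := by
  have : perSet f ε = ⋂ x, {t | ‖f (x + t) - f x‖ ≤ ε} := by
    ext t; simp [perSet]
  rw [this]
  exact isClosed_iInter fun x => isClosed_le (by fun_prop) continuous_const

lemma GAP.perSet_density {f : EuclideanSpace ℝ (Fin d) → ℂ} (hf : GAP f) {ε : ℝ} (hε : 0 < ε) :
    ∃ c : ℝ, 0 < c ∧ ∃ L0 : ℝ, 0 < L0 ∧ ∀ L, L0 ≤ L →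
      c * (2 * L) ^ d ≤ volume.real (perSet f ε ∩ cube d L) := by
  obtain ⟨s, hs⟩ := hf.tb ε hε
  set r : ℝ := 1 + ∑ i ∈ s, ‖i‖ with hr
  have hr1 : 1 ≤ r := by
    have : 0 ≤ ∑ i ∈ s, ‖i‖ := Finset.sum_nonneg fun _ _ => norm_nonneg _
    linarith
  have hri : ∀ i ∈ s, ‖i‖ ≤ r := fun i hi => by
    have := Finset.single_le_sum (f := fun i => ‖i‖) (fun _ _ => norm_nonneg _) hi
    linarith
  have key : ∀ L, 0 ≤ L → (2 * L) ^ d ≤ s.card * volume.real (perSet f ε ∩ cube d (L + r)) := by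
    intro L hL
    have hsub : cube d L ⊆ ⋃ i ∈ s, (fun x => x - i) ⁻¹' (perSet f ε ∩ cube d (L + r)) := by
      intro t ht
      obtain ⟨i, hi, hit⟩ := hs t
      simp only [Set.mem_iUnion]
      refine ⟨i, hi, ?_, ?_⟩
      · intro x
        have := hit (x - i)
        rw [sub_add_cancel] at this
        rw [show x + (t - i) = x - i + t by abel]
        exact this.le
      · intro j
        have h1 := ht j
        have h2 := (coord_le_norm i j).trans (hri i hi)
        simp only [PiLp.sub_apply]
        exact (abs_sub _ _).trans (add_le_add h1 h2)
    have hv : ∀ i, volume.real ((fun x => x - i) ⁻¹' (perSet f ε ∩ cube d (L + r)))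
        = volume.real (perSet f ε ∩ cube d (L + r)) := by
      intro i
      have := measure_preimage_add_right volume (-i) (perSet f ε ∩ cube d (L + r))
      simp only [← sub_eq_add_neg] at this
      simp only [Measure.real, this]
    have hfin : volume (perSet f ε ∩ cube d (L + r)) ≠ ⊤ :=
      ((measure_mono Set.inter_subset_right).trans_lt (volume_cube_lt_top _)).ne
    calc (2 * L) ^ d = volume.real (cube d L) := (volume_real_cube L hL).symm
      _ ≤ volume.real (⋃ i ∈ s, (fun x => x - i) ⁻¹' (perSet f ε ∩ cube d (L + r))) := by
        refine measureReal_mono hsub ?_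
        refine ((measure_biUnion_finset_le s _).trans_lt (ENNReal.sum_lt_top.2 fun i _ => ?_)).ne
        have := measure_preimage_add_right volume (-i) (perSet f ε ∩ cube d (L + r))
        simp only [← sub_eq_add_neg] at this
        rw [this]
        exact hfin.lt_top
      _ ≤ ∑ i ∈ s, volume.real ((fun x => x - i) ⁻¹' (perSet f ε ∩ cube d (L + r))) :=
        measureReal_biUnion_finset_le s _
      _ = _ := by rw [Finset.sum_congr rfl fun i _ => hv i]; simp
  have hcard : 0 < s.card := by
    obtain ⟨i, hi, _⟩ := hs 0
    exact Finset.card_pos.2 ⟨i, hi⟩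
  refine ⟨(s.card * 2 ^ d : ℝ)⁻¹, by positivity, 2 * r, by linarith, fun L hL => ?_⟩
  have h1 := key (L - r) (by linarith)
  rw [sub_add_cancel] at h1
  have h2 : (L : ℝ) ^ d ≤ (2 * (L - r)) ^ d := pow_le_pow_left₀ (by linarith) (by linarith) d
  rw [inv_mul_le_iff₀ (by positivity), mul_pow]
  have : (0:ℝ) ≤ 2 ^ d := by positivity
  calc (2:ℝ) ^ d * L ^ d ≤ 2 ^ d * (s.card * volume.real (perSet f ε ∩ cube d L)) :=
      mul_le_mul_of_nonneg_left (h2.trans h1) this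
    _ = _ := by ring

/-- cut-off -/
def cutf (L : ℝ) (g : EuclideanSpace ℝ (Fin d) → ℂ) : EuclideanSpace ℝ (Fin d) → ℂ :=
  (cube d L).indicator g

/-- autocorrelation -/
def autoc (L : ℝ) (g : EuclideanSpace ℝ (Fin d) → ℂ) (t : EuclideanSpace ℝ (Fin d)) : ℂ :=
  ∫ s, cutf L g s * conj (cutf L g (s - t))

lemma cutf_integrable (L : ℝ) {g : EuclideanSpace ℝ (Fin d) → ℂ} (hg : Continuous g) :
    Integrable (cutf L g) :=
  (integrable_indicator_iff (measurableSet_cube L)).2 (integrableOn_cube hg L)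

lemma cutf_norm_le {L C : ℝ} (hC0 : 0 ≤ C) {g : EuclideanSpace ℝ (Fin d) → ℂ}
    (hC : ∀ x, ‖g x‖ ≤ C) (x) : ‖cutf L g x‖ ≤ C := by
  unfold cutf
  exact (norm_indicator_le_norm_self g x).trans (hC x)

lemma memLp_two_of_bdd {w : EuclideanSpace ℝ (Fin d) → ℂ} (hw : Integrable w) {C : ℝ}
    (hC : ∀ x, ‖w x‖ ≤ C) : MemLp w 2 := by
  rw [memLp_two_iff_integrable_sq_norm hw.1]
  refine (hw.norm.const_mul C).mono' (hw.1.norm.pow 2) (Eventually.of_forall fun x => ?_)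
  rw [Real.norm_of_nonneg (by positivity), sq]
  exact mul_le_mul_of_nonneg_right (hC x) (norm_nonneg _)

lemma integral_cutf_norm {L C : ℝ} (hL : 0 ≤ L) {g : EuclideanSpace ℝ (Fin d) → ℂ}
    (hC : ∀ x, ‖g x‖ ≤ C) : ∫ x, ‖cutf L g x‖ ^ 2 ≤ C ^ 2 * (2 * L) ^ d := by
  have hC0 : 0 ≤ C := (norm_nonneg _).trans (hC 0)
  have : (fun x => ‖cutf L g x‖ ^ 2) = (cube d L).indicator (fun x => ‖g x‖ ^ 2) := by
    ext x
    unfold cutf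
    by_cases h : x ∈ cube d L <;> simp [h]
  rw [this, integral_indicator (measurableSet_cube L)]
  have h := norm_setIntegral_le_of_norm_le_const (μ := volume) (s := cube d L)
    (f := fun x => ‖g x‖ ^ 2) (C := C ^ 2) (volume_cube_lt_top L) (fun x _ => by
      rw [Real.norm_of_nonneg (by positivity)]
      exact pow_le_pow_left₀ (norm_nonneg _) (hC x) 2)
  rw [volume_real_cube L hL] at h
  exact (Real.le_norm_self _).trans h

lemma norm_fourier_cutf {L : ℝ} (hL : 0 < L) (g : EuclideanSpace ℝ (Fin d) → ℂ)
    (ξ : EuclideanSpace ℝ (Fin d)) :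
    ‖𝓕 (cutf L g) ξ‖ = (2 * L) ^ d * ‖avg L (fun x => eChar ξ x * g x) 0‖ := by
  have h : 𝓕 (cutf L g) ξ = ∫ x in cube d L, eChar ξ x * g x := by
    rw [Real.fourier_eq', ← integral_indicator (measurableSet_cube L)]
    congr 1; ext x
    unfold cutf
    by_cases h : x ∈ cube d L
    · simp [h, eChar, smul_eq_mul]
    · simp [h]
  rw [h]
  unfold avg
  simp only [add_zero]
  have h2 : (0:ℝ) < (2 * L) ^ d := by positivity
  rw [norm_smul, norm_inv, Real.norm_of_nonneg h2.le, mul_inv_cancel_left₀ h2.ne']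

lemma autoc_upper {L C ε : ℝ} (hL : 0 < L) {g : EuclideanSpace ℝ (Fin d) → ℂ} (hg : Continuous g)
    (hC : ∀ x, ‖g x‖ ≤ C) (hε : ∀ k, ‖avg L (fun x => eChar k x * g x) 0‖ ≤ ε) :
    Integrable (fun t => ‖autoc L g t‖ ^ 2) ∧
    ∫ t, ‖autoc L g t‖ ^ 2 ≤ ((2 * L) ^ d * ε) ^ 2 * (C ^ 2 * (2 * L) ^ d) := by
  have hC0 : 0 ≤ C := (norm_nonneg _).trans (hC 0)
  have hε0 : 0 ≤ ε := (norm_nonneg _).trans (hε 0)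
  set v := cutf L g with hv
  set v' : EuclideanSpace ℝ (Fin d) → ℂ := fun x => conj (v (-x)) with hv'
  have hvi : Integrable v := cutf_integrable L hg
  have hvi' : Integrable v' := by
    have := hvi.comp_neg
    exact (Complex.conjLIE.toContinuousLinearEquiv : ℂ ≃L[ℝ] ℂ).toContinuousLinearMap.integrable_comp this
  have hvb : ∀ x, ‖v x‖ ≤ C := cutf_norm_le hC0 hC
  have hvb' : ∀ x, ‖v' x‖ ≤ C := fun x => by
    simp only [hv', RCLike.norm_conj]; exact hvb _
  have hu : autoc L g = v ⋆[ContinuousLinearMap.mul ℂ ℂ] v' := by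
    ext t
    simp only [autoc, convolution_def, hv', neg_sub, ContinuousLinearMap.mul_apply', hv]
  have hui : Integrable (autoc L g) := by
    rw [hu]; exact hvi.integrable_convolution _ hvi'
  have hub : ∀ t, ‖autoc L g t‖ ≤ C * ∫ s, ‖v s‖ := by
    intro t
    unfold autoc
    rw [← integral_const_mul]
    refine norm_integral_le_of_norm_le (hvi.norm.const_mul C) (Eventually.of_forall fun s => ?_)
    rw [norm_mul, RCLike.norm_conj, mul_comm]
    exact mul_le_mul_of_nonneg_right (hvb _) (norm_nonneg _)
  have hu2 := memLp_two_of_bdd hui hub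
  refine ⟨(memLp_two_iff_integrable_sq_norm hui.1).1 hu2, ?_⟩
  have hp := planch hui hu2
  rw [← hp.2]
  have hp' := planch hvi' (memLp_two_of_bdd hvi' hvb')
  have hcomp : ∀ ξ, ‖𝓕 (autoc L g) ξ‖ ^ 2 ≤ ((2 * L) ^ d * ε) ^ 2 * ‖𝓕 v' ξ‖ ^ 2 := by
    intro ξ
    rw [hu, Real.fourier_mul_convolution_eq hvi hvi', norm_mul, mul_pow, norm_fourier_cutf hL]
    gcongr
    exact hε ξ
  have hi1 := (memLp_two_iff_integrable_sq_norm hp.1.1).1 hp.1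
  have hi2 := (memLp_two_iff_integrable_sq_norm hp'.1.1).1 hp'.1
  calc ∫ ξ, ‖𝓕 (autoc L g) ξ‖ ^ 2 ≤ ∫ ξ, ((2 * L) ^ d * ε) ^ 2 * ‖𝓕 v' ξ‖ ^ 2 :=
        integral_mono hi1 (hi2.const_mul _) hcomp
    _ = ((2 * L) ^ d * ε) ^ 2 * ∫ x, ‖v' x‖ ^ 2 := by rw [integral_const_mul, hp'.2]
    _ = ((2 * L) ^ d * ε) ^ 2 * ∫ x, ‖v x‖ ^ 2 := by
        congr 1
        simp only [hv', RCLike.norm_conj]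
        exact integral_neg_eq_self (fun x => ‖v x‖ ^ 2) volume
    _ ≤ _ := by
        refine mul_le_mul_of_nonneg_left (integral_cutf_norm hL.le hC) (by positivity)

lemma autoc_lower {L C ε m : ℝ} (hL : 0 < L) {g : EuclideanSpace ℝ (Fin d) → ℂ} (hg : Continuous g)
    (hC : ∀ x, ‖g x‖ ≤ C) (hm : m ≤ ‖g 0‖) (hm0 : 0 < m) {t : EuclideanSpace ℝ (Fin d)}
    (ht : t ∈ perSet g ε) (htc : t ∈ cube d (L / 2)) :
    (m / 2) ^ 2 * volume.real (perSet g (m / 2) ∩ cube d (L / 2)) - C * ε * (2 * L) ^ d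
      ≤ ‖autoc L g t‖ := by
  have hC0 : 0 ≤ C := (norm_nonneg _).trans (hC 0)
  have hε0 : 0 ≤ ε := (norm_nonneg _).trans (ht 0)
  set Q : Set (EuclideanSpace ℝ (Fin d)) := cube d L ∩ (fun s => s - t) ⁻¹' cube d L with hQ
  have hQm : MeasurableSet Q := (measurableSet_cube L).inter
    ((measurableSet_cube L).preimage (measurable_id.sub_const t))
  have hQL : Q ⊆ cube d L := Set.inter_subset_left
  have hQf : volume Q < ⊤ := (measure_mono hQL).trans_lt (volume_cube_lt_top L)
  have e1 : autoc L g t = ∫ s in Q, g s * conj (g (s - t)) := by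
    unfold autoc cutf
    rw [← integral_indicator hQm]
    congr 1; ext s
    by_cases h1 : s ∈ cube d L <;> by_cases h2 : s - t ∈ cube d L <;> simp [hQ, h1, h2]
  have i1 : IntegrableOn (fun s => ((‖g s‖ ^ 2 : ℝ) : ℂ)) Q :=
    (integrableOn_cube (F := fun s => ((‖g s‖ ^ 2 : ℝ) : ℂ)) (by fun_prop) L).mono_set hQL
  have hcj : Continuous (fun s => g s * conj (g s - g (s - t))) := by
    refine hg.mul (Complex.continuous_conj.comp ?_); fun_prop
  have i2 : IntegrableOn (fun s => g s * conj (g s - g (s - t))) Q :=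
    (integrableOn_cube hcj L).mono_set hQL
  have e2 : autoc L g t = ((∫ s in Q, ‖g s‖ ^ 2 : ℝ) : ℂ) - ∫ s in Q, g s * conj (g s - g (s - t)) := by
    rw [e1, ← integral_complex_ofReal, ← integral_sub i1 i2]
    congr 1; ext s
    rw [map_sub, mul_sub, Complex.mul_conj, Complex.normSq_eq_norm_sq]
    ring
  have b1 : ‖∫ s in Q, g s * conj (g s - g (s - t))‖ ≤ C * ε * (2 * L) ^ d := by
    have := norm_setIntegral_le_of_norm_le_const (μ := volume) (s := Q)
      (f := fun s => g s * conj (g s - g (s - t))) (C := C * ε) hQf (fun s _ => by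
        rw [norm_mul, RCLike.norm_conj]
        have h := ht (s - t)
        rw [sub_add_cancel] at h
        exact mul_le_mul (hC s) h (norm_nonneg _) hC0)
    refine this.trans (mul_le_mul_of_nonneg_left ?_ (by positivity))
    rw [← volume_real_cube L hL.le]
    exact measureReal_mono hQL (volume_cube_lt_top L).ne
  set A := perSet g (m / 2) ∩ cube d (L / 2) with hA
  have hAm : MeasurableSet A := (isClosed_perSet hg _).measurableSet.inter (measurableSet_cube _)
  have hAQ : A ⊆ Q := by
    rintro s ⟨-, hs⟩
    refine ⟨cube_mono (by linarith) hs, fun i => ?_⟩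
    have h1 := hs i
    have h2 := htc i
    simp only [PiLp.sub_apply]
    refine (abs_sub _ _).trans ?_
    linarith
  have i3 : IntegrableOn (fun s => ‖g s‖ ^ 2) Q := by
    have : ContinuousOn (fun s => ‖g s‖ ^ 2) (cube d L) := by fun_prop
    exact (this.integrableOn_compact (isCompact_cube L)).mono_set hQL
  have b2 : (m / 2) ^ 2 * volume.real A ≤ ∫ s in Q, ‖g s‖ ^ 2 := by
    refine (setIntegral_ge_of_const_le_real hAm ((measure_mono hAQ).trans_lt hQf).ne (fun s hs => ?_)
      (i3.mono_set hAQ)).trans (setIntegral_mono_set i3 (Eventually.of_forall fun s => by positivity)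
        (Eventually.of_forall hAQ))
    have h := hs.1 0
    rw [zero_add] at h
    have := norm_sub_norm_le (g 0) (g s)
    rw [norm_sub_rev] at this
    exact pow_le_pow_left₀ (by linarith) (by linarith) 2
  rw [e2]
  have h5 := norm_sub_norm_le ((∫ s in Q, ‖g s‖ ^ 2 : ℝ) : ℂ) (∫ s in Q, g s * conj (g s - g (s - t)))
  rw [Complex.norm_real, Real.norm_eq_abs] at h5
  have := le_abs_self (∫ s in Q, ‖g s‖ ^ 2)
  linarith

lemma GAP.translate {f : EuclideanSpace ℝ (Fin d) → ℂ} (hf : GAP f) (y : EuclideanSpace ℝ (Fin d)) :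
    GAP (fun x => f (x + y)) := by
  refine ⟨?_, ?_, fun ε hε => ?_⟩
  · exact hf.uc.comp (uniformContinuous_id.add uniformContinuous_const)
  · obtain ⟨C, hC⟩ := hf.bdd
    exact ⟨C, fun x => hC _⟩
  · obtain ⟨s, hs⟩ := hf.tb ε hε
    refine ⟨s, fun t => ?_⟩
    obtain ⟨i, hi, hit⟩ := hs t
    refine ⟨i, hi, fun x => ?_⟩
    have := hit (x + y)
    rwa [add_right_comm, add_right_comm x i]

/-- Uniqueness theorem: an almost periodic function with vanishing Fourier–Bohr coefficients is 0. -/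
theorem GAP.eq_zero {f : EuclideanSpace ℝ (Fin d) → ℂ} (hf : GAP f)
    (h0 : ∀ k, HasMean (fun x => _root_.eChar k x * f x) 0) (x0 : EuclideanSpace ℝ (Fin d)) :
    f x0 = 0 := by
  by_contra hne
  set g : EuclideanSpace ℝ (Fin d) → ℂ := fun x => f (x + x0) with hgdef
  have hg : GAP g := hf.translate x0
  have hgc : Continuous g := hg.uc.continuous
  obtain ⟨C, hC⟩ := hg.bdd
  have hC0 : 0 ≤ C := (norm_nonneg _).trans (hC 0)
  set m := ‖g 0‖ with hm
  have hm0 : 0 < m := by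
    rw [hm, norm_pos_iff]; simpa [hgdef] using hne
  obtain ⟨c, hc, L1, hL1p, hL1⟩ := hg.perSet_density (ε := m / 2) (by linarith)
  set b : ℝ := (m / 2) ^ 2 * c / 2 ^ d / 2 with hb
  have hbp : 0 < b := by positivity
  obtain ⟨c', hc', L2, hL2p, hL2⟩ := hg.perSet_density (ε := b / (C + 1)) (by positivity)
  obtain ⟨ε, hε, hε2⟩ : ∃ ε : ℝ, 0 < ε ∧ ε ^ 2 * C ^ 2 < b ^ 2 * c' / 2 ^ d := by
    have hlim : Tendsto (fun ε : ℝ => ε ^ 2 * C ^ 2) (𝓝[>] 0) (𝓝 0) := by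
      have : Continuous (fun ε : ℝ => ε ^ 2 * C ^ 2) := by fun_prop
      have := this.tendsto 0
      simp only [ne_eq, OfNat.ofNat_ne_zero, not_false_eq_true, zero_pow, zero_mul] at this
      exact this.mono_left nhdsWithin_le_nhds
    obtain ⟨ε, h1, h2⟩ := ((hlim.eventually (gt_mem_nhds (by positivity : 0 < b ^ 2 * c' / 2 ^ d))).and
      self_mem_nhdsWithin).exists
    exact ⟨ε, h2, h1⟩
  obtain ⟨L3, hL3⟩ := hf.unif_avg_all h0 hε
  set L := max (max (2 * L1) (2 * L2)) L3 with hLdef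
  have hLL1 : L1 ≤ L / 2 := by
    have : 2 * L1 ≤ L := (le_max_left _ _).trans (le_max_left _ _)
    linarith
  have hLL2 : L2 ≤ L / 2 := by
    have : 2 * L2 ≤ L := (le_max_right _ _).trans (le_max_left _ _)
    linarith
  have hLp : 0 < L := by linarith
  obtain ⟨hintg, hup⟩ := autoc_upper hLp hgc hC (ε := ε) (fun k => by
    have := hL3 L (le_max_right _ _) k x0
    rwa [norm_avg_eChar_mul] at this)
  set V : ℝ := (2 * L) ^ d with hV
  have hVp : 0 < V := by positivity
  have hV2 : (2 * (L / 2)) ^ d = V / 2 ^ d := by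
    rw [hV, ← div_pow]; congr 1; ring
  set A := perSet g (b / (C + 1)) ∩ cube d (L / 2) with hA
  have hAm : MeasurableSet A := (isClosed_perSet hgc _).measurableSet.inter (measurableSet_cube _)
  have hlow : ∀ t ∈ A, (b * V) ^ 2 ≤ ‖autoc L g t‖ ^ 2 := by
    intro t ht
    have h1 := autoc_lower hLp hgc hC (le_refl m) hm0 ht.1 ht.2
    have h2 := hL1 _ hLL1
    rw [hV2] at h2
    refine pow_le_pow_left₀ (by positivity) (le_trans ?_ h1) 2
    have h3 : (m / 2) ^ 2 * (c * (V / 2 ^ d)) ≤ (m / 2) ^ 2 * volume.real (perSet g (m / 2) ∩ cube d (L / 2)) :=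
      mul_le_mul_of_nonneg_left h2 (by positivity)
    have h4 : (m / 2) ^ 2 * (c * (V / 2 ^ d)) = 2 * b * V := by rw [hb]; field_simp
    have h5 : C * (b / (C + 1)) ≤ b := by
      rw [mul_div_assoc', div_le_iff₀ (by positivity)]; nlinarith
    have h6 : C * (b / (C + 1)) * V ≤ b * V := mul_le_mul_of_nonneg_right h5 hVp.le
    linarith
  have hAf : volume A ≠ ⊤ := ((measure_mono Set.inter_subset_right).trans_lt (volume_cube_lt_top _)).ne
  have h7 : (b * V) ^ 2 * volume.real A ≤ ∫ t, ‖autoc L g t‖ ^ 2 :=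
    (setIntegral_ge_of_const_le_real hAm hAf hlow hintg.integrableOn).trans
      (setIntegral_le_integral hintg (Eventually.of_forall fun s => by positivity))
  have h8 := hL2 _ hLL2
  rw [hV2] at h8
  have h9 : (b * V) ^ 2 * (c' * (V / 2 ^ d)) ≤ (V * ε) ^ 2 * (C ^ 2 * V) :=
    (mul_le_mul_of_nonneg_left h8 (by positivity)).trans (h7.trans hup)
  have h10 : (b * V) ^ 2 * (c' * (V / 2 ^ d)) = (b ^ 2 * c' / 2 ^ d) * V ^ 3 := by ring
  have h11 : (V * ε) ^ 2 * (C ^ 2 * V) = (ε ^ 2 * C ^ 2) * V ^ 3 := by ring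
  rw [h10, h11] at h9
  have := mul_lt_mul_of_pos_right hε2 (by positivity : 0 < V ^ 3)
  linarith

end Uniq

section Exch
open scoped FourierTransform ContDiff LineDeriv
variable {d : ℕ}

def cv (h φ : 𝓢(EuclideanSpace ℝ (Fin d), ℂ)) : 𝓢(EuclideanSpace ℝ (Fin d), ℂ) :=
  SchwartzMap.convolution (ContinuousLinearMap.mul ℂ ℂ) h φ

lemma cv_apply (h φ : 𝓢(EuclideanSpace ℝ (Fin d), ℂ)) (x : EuclideanSpace ℝ (Fin d)) :
    cv h φ x = ∫ s, h s * φ (x - s) := by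
  rw [cv, SchwartzMap.convolution_apply]; rfl

lemma fourier_cv (h φ : 𝓢(EuclideanSpace ℝ (Fin d), ℂ)) (x : EuclideanSpace ℝ (Fin d)) :
    𝓕 (cv h φ) x = 𝓕 h x * 𝓕 φ x := by
  rw [cv, SchwartzMap.fourier_convolution]; rfl

lemma fourier_inj {f g : 𝓢(EuclideanSpace ℝ (Fin d), ℂ)} (h : 𝓕 f = 𝓕 g) : f = g := by
  have := congrArg (fun u => 𝓕⁻ u) h
  simpa using this

lemma lineDeriv_cv (h φ : 𝓢(EuclideanSpace ℝ (Fin d), ℂ)) (m : EuclideanSpace ℝ (Fin d)) :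
    ∂_{m} (cv h φ) = cv h (∂_{m} φ) := by
  apply fourier_inj
  ext x
  have : (inner ℝ · m : EuclideanSpace ℝ (Fin d) → ℝ).HasTemperateGrowth := by fun_prop
  rw [fourier_cv, SchwartzMap.fourier_lineDerivOp_eq, SchwartzMap.fourier_lineDerivOp_eq]
  simp [smulLeftCLM_apply_apply this, fourier_cv]
  ring

lemma iterLineDeriv_cv (h φ : 𝓢(EuclideanSpace ℝ (Fin d), ℂ)) (n : ℕ) (m : Fin n → EuclideanSpace ℝ (Fin d)) :
    ∂^{m} (cv h φ) = cv h (∂^{m} φ) := by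
  induction n with
  | zero => simp
  | succ n ih => 
    rw [LineDeriv.iteratedLineDerivOp_succ_left, LineDeriv.iteratedLineDerivOp_succ_left, ih, lineDeriv_cv]

lemma iterFDeriv_cv (h φ : 𝓢(EuclideanSpace ℝ (Fin d), ℂ)) (n : ℕ) (m : Fin n → EuclideanSpace ℝ (Fin d))
    (x : EuclideanSpace ℝ (Fin d)) :
    iteratedFDeriv ℝ n (cv h φ) x m = ∫ s, h s * iteratedFDeriv ℝ n φ (x - s) m := by
  rw [← SchwartzMap.iteratedLineDerivOp_eq_iteratedFDeriv, iterLineDeriv_cv, cv_apply]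
  simp only [SchwartzMap.iteratedLineDerivOp_eq_iteratedFDeriv]

lemma iterFDeriv_tr (φ : 𝓢(EuclideanSpace ℝ (Fin d), ℂ)) (n : ℕ) (z x : EuclideanSpace ℝ (Fin d)) :
    iteratedFDeriv ℝ n (SchwartzMap.compSubConstCLM ℂ z φ) x = iteratedFDeriv ℝ n φ (x - z) := by
  have : (⇑(SchwartzMap.compSubConstCLM ℂ z φ) : EuclideanSpace ℝ (Fin d) → ℂ) = fun y => φ (y - z) := rfl
  rw [this, iteratedFDeriv_comp_sub]

/-- mean value bound -/
lemma mv_bound (φ : 𝓢(EuclideanSpace ℝ (Fin d), ℂ)) (k n : ℕ) :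
    ∃ A, 0 ≤ A ∧ ∀ (r : ℝ) (a b x : EuclideanSpace ℝ (Fin d)), ‖a‖ ≤ r → ‖b‖ ≤ r →
      ‖x‖ ^ k * ‖iteratedFDeriv ℝ n φ (x - a) - iteratedFDeriv ℝ n φ (x - b)‖ ≤
        ‖a - b‖ * (A * (1 + r ^ k)) := by
  set P := SchwartzMap.seminorm ℝ k (n+1) φ
  set Q := SchwartzMap.seminorm ℝ 0 (n+1) φ
  have hP : 0 ≤ P := apply_nonneg _ _
  have hQ : 0 ≤ Q := apply_nonneg _ _
  refine ⟨2 ^ k * (P + Q), by positivity, fun r a b x ha hb => ?_⟩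
  have hr : 0 ≤ r := (norm_nonneg a).trans ha
  have hdiff : ∀ y, DifferentiableAt ℝ (iteratedFDeriv ℝ n φ) y := fun y => 
    (φ.smooth ⊤).differentiable_iteratedFDeriv (mod_cast ENat.natCast_lt_top n) y
  by_cases hx : x = 0 ∧ k ≠ 0
  · rw [hx.1, norm_zero, zero_pow hx.2, zero_mul]; positivity
  have key : ∀ y ∈ Metric.closedBall x r, ‖x‖ ^ k * ‖fderiv ℝ (iteratedFDeriv ℝ n φ) y‖ ≤ 2 ^ k * (P + Q) * (1 + r ^ k) := by
    intro y hy
    rw [norm_fderiv_iteratedFDeriv]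
    have h1 := φ.le_seminorm ℝ k (n+1) y
    have h2 := φ.le_seminorm ℝ 0 (n+1) y
    rw [pow_zero, one_mul] at h2
    have h3 : ‖x‖ ≤ ‖y‖ + r := by
      rw [mem_closedBall, dist_comm, dist_eq_norm] at hy
      have := norm_add_le y (x - y)
      simp at this; linarith
    have h4 : ‖x‖ ^ k ≤ 2 ^ k * (‖y‖ ^ k + r ^ k) := by
      calc ‖x‖ ^ k ≤ (‖y‖ + r) ^ k := by gcongr
        _ ≤ 2 ^ (k-1) * (‖y‖ ^ k + r ^ k) := add_pow_le (norm_nonneg _) hr k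
        _ ≤ _ := by gcongr <;> first | norm_num | omega
    set D := ‖iteratedFDeriv ℝ (n+1) φ y‖
    have hD : 0 ≤ D := norm_nonneg _
    have hrk : 0 ≤ r ^ k := by positivity
    calc ‖x‖ ^ k * D ≤ 2 ^ k * (‖y‖ ^ k + r ^ k) * D := by gcongr
      _ = 2 ^ k * (‖y‖ ^ k * D + r ^ k * D) := by ring
      _ ≤ 2 ^ k * (P + r ^ k * Q) := by gcongr <;> assumption
      _ ≤ 2 ^ k * ((P + Q) * (1 + r ^ k)) := by gcongr; nlinarith
      _ = _ := by ring
  have hpos : 0 < ‖x‖ ^ k := by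
    by_cases hk : k = 0
    · simp [hk]
    · have : x ≠ 0 := fun h => hx ⟨h, hk⟩
      positivity
  have := (convex_closedBall x r).norm_image_sub_le_of_norm_fderiv_le (𝕜 := ℝ) (f := iteratedFDeriv ℝ n φ)
    (C := 2 ^ k * (P + Q) * (1 + r ^ k) / ‖x‖ ^ k) (x := x - b) (y := x - a)
    (fun y _ => hdiff y) (fun y hy => by rw [le_div_iff₀ hpos, mul_comm]; exact key y hy)
    (by simpa using hb) (by simpa using ha)
  calc _ ≤ ‖x‖ ^ k * (2 ^ k * (P + Q) * (1 + r ^ k) / ‖x‖ ^ k * ‖x - a - (x - b)‖) := by gcongr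
    _ = ‖a - b‖ * (2 ^ k * (P + Q) * (1 + r ^ k)) := by
      rw [show x - a - (x - b) = -(a - b) by abel, norm_neg]; field_simp

lemma simple_sum (e : SimpleFunc (EuclideanSpace ℝ (Fin d)) (EuclideanSpace ℝ (Fin d)))
    {h : EuclideanSpace ℝ (Fin d) → ℂ} (hh : Integrable h) (Ψ : EuclideanSpace ℝ (Fin d) → ℂ) :
    ∑ z ∈ e.range, (∫ s in e ⁻¹' {z}, h s) * Ψ z = ∫ s, h s * Ψ (e s) := by
  have h1 : ∀ s, h s * Ψ (e s) = ∑ z ∈ e.range, (e ⁻¹' {z}).indicator (fun s => h s * Ψ z) s := by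
    intro s
    rw [Finset.sum_eq_single (e s)]
    · rw [Set.indicator_of_mem]; simp
    · intro z _ hz
      rw [Set.indicator_of_notMem]; simpa using hz.symm
    · intro hs; exact absurd (e.mem_range_self s) hs
  simp_rw [h1]
  rw [integral_finsetSum]
  · refine Finset.sum_congr rfl fun z _ => ?_
    rw [integral_indicator (e.measurableSet_preimage _), integral_mul_const]
  · intro z _
    exact (hh.mul_const _).indicator (e.measurableSet_preimage _)
end Exch

section Exch2
open scoped FourierTransform ContDiff LineDeriv
variable {d : ℕ}

def aps (d j : ℕ) : SimpleFunc (EuclideanSpace ℝ (Fin d)) (EuclideanSpace ℝ (Fin d)) :=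
  SimpleFunc.approxOn id measurable_id Set.univ 0 (Set.mem_univ _) j

lemma aps_tendsto (s : EuclideanSpace ℝ (Fin d)) : Tendsto (fun j => aps d j s) atTop (𝓝 s) := by
  have := SimpleFunc.tendsto_approxOn (f := (id : EuclideanSpace ℝ (Fin d) → EuclideanSpace ℝ (Fin d))) measurable_id (Set.mem_univ 0) (x := s) (by simp)
  exact this

lemma aps_norm (j : ℕ) (s : EuclideanSpace ℝ (Fin d)) : ‖aps d j s‖ ≤ 2 * ‖s‖ := by
  have := SimpleFunc.norm_approxOn_zero_le (f := (id : EuclideanSpace ℝ (Fin d) → EuclideanSpace ℝ (Fin d))) measurable_id (Set.mem_univ 0) s j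
  rw [two_mul]; exact this

def uj (h φ : 𝓢(EuclideanSpace ℝ (Fin d), ℂ)) (j : ℕ) : 𝓢(EuclideanSpace ℝ (Fin d), ℂ) :=
  ∑ z ∈ (aps d j).range, (∫ s in (aps d j) ⁻¹' {z}, h s) • SchwartzMap.compSubConstCLM ℂ z φ

lemma uj_fderiv (h φ : 𝓢(EuclideanSpace ℝ (Fin d), ℂ)) (j n : ℕ) (x : EuclideanSpace ℝ (Fin d))
    (m : Fin n → EuclideanSpace ℝ (Fin d)) :
    iteratedFDeriv ℝ n (uj h φ j) x m = ∫ s, h s * iteratedFDeriv ℝ n φ (x - aps d j s) m := by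
  rw [← simple_sum (aps d j) h.integrable (fun z => iteratedFDeriv ℝ n φ (x - z) m)]
  rw [← SchwartzMap.iteratedLineDerivOp_eq_iteratedFDeriv, uj,
    ← LineDeriv.iteratedLineDerivOpCLM_apply (R := ℂ), map_sum, SchwartzMap.sum_apply]
  refine Finset.sum_congr rfl fun z _ => ?_
  rw [map_smul, SchwartzMap.smul_apply, LineDeriv.iteratedLineDerivOpCLM_apply, 
    SchwartzMap.iteratedLineDerivOp_eq_iteratedFDeriv, iterFDeriv_tr, smul_eq_mul]

lemma meas_aux (h φ : 𝓢(EuclideanSpace ℝ (Fin d), ℂ)) (n : ℕ) (x : EuclideanSpace ℝ (Fin d))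
    (m : Fin n → EuclideanSpace ℝ (Fin d)) (e : EuclideanSpace ℝ (Fin d) → EuclideanSpace ℝ (Fin d))
    (he : Measurable e) : Integrable (fun s => h s * iteratedFDeriv ℝ n φ (x - e s) m) := by
  have hc : Continuous (fun y => iteratedFDeriv ℝ n φ y m) := by
    have := (φ.smooth ⊤).continuous_iteratedFDeriv (m := n) (mod_cast le_top)
    fun_prop
  refine h.integrable.mul_bdd (c := SchwartzMap.seminorm ℝ 0 n φ * ∏ i, ‖m i‖) 
    (hc.measurable.comp (measurable_const.sub he)).aestronglyMeasurable (Eventually.of_forall fun s => ?_)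
  refine (ContinuousMultilinearMap.le_opNorm _ _).trans ?_
  gcongr
  simpa using φ.le_seminorm ℝ 0 n (x - e s)

lemma uj_tendsto (h φ : 𝓢(EuclideanSpace ℝ (Fin d), ℂ)) : Tendsto (uj h φ) atTop (𝓝 (cv h φ)) := by
  rw [(schwartz_withSeminorms ℂ (EuclideanSpace ℝ (Fin d)) ℂ).tendsto_nhds]
  rintro ⟨k, n⟩
  obtain ⟨A, hA, hb⟩ := mv_bound φ k n
  set B : ℕ → ℝ := fun j => ∫ s, ‖h s‖ * (‖aps d j s - s‖ * (A * (1 + (2 * ‖s‖) ^ k)))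
  have hint0 : Integrable (fun s => ‖h s‖ * ((3 * ‖s‖) * (A * (1 + (2 * ‖s‖) ^ k)))) := by
    have h1 := (h.integrable_pow_mul volume 1).const_mul (3 * A)
    have h2 := (h.integrable_pow_mul volume (k+1)).const_mul (3 * A * 2 ^ k)
    refine (h1.add h2).congr (Eventually.of_forall fun s => ?_)
    simp only [Pi.add_apply]; ring
  have hle : ∀ j s, ‖h s‖ * (‖aps d j s - s‖ * (A * (1 + (2 * ‖s‖) ^ k))) ≤
      ‖h s‖ * ((3 * ‖s‖) * (A * (1 + (2 * ‖s‖) ^ k))) := by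
    intro j s
    gcongr
    have := aps_norm j s
    have := norm_sub_le (aps d j s) s
    linarith
  have hmeas : ∀ j, AEStronglyMeasurable (fun s => ‖h s‖ * (‖aps d j s - s‖ * (A * (1 + (2 * ‖s‖) ^ k)))) volume := by
    intro j
    have h1 : Measurable (fun s => ‖aps d j s - s‖) := ((aps d j).measurable.sub measurable_id).norm
    have h2 : Measurable (fun s => ‖h s‖) := h.continuous.norm.measurable
    have h3 : Measurable (fun s : EuclideanSpace ℝ (Fin d) => A * (1 + (2 * ‖s‖) ^ k)) := by
      apply Continuous.measurable; fun_prop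
    exact (h2.mul (h1.mul h3)).aestronglyMeasurable
  have hnn : ∀ j s, 0 ≤ ‖h s‖ * (‖aps d j s - s‖ * (A * (1 + (2 * ‖s‖) ^ k))) := fun j s => by positivity
  have hintg : ∀ j, Integrable (fun s => ‖h s‖ * (‖aps d j s - s‖ * (A * (1 + (2 * ‖s‖) ^ k)))) := by
    intro j
    refine hint0.mono' (hmeas j) (Eventually.of_forall fun s => ?_)
    rw [Real.norm_of_nonneg (hnn j s)]
    exact hle j s
  have hB : Tendsto B atTop (𝓝 0) := by
    have := tendsto_integral_of_dominated_convergence (f := fun _ => (0:ℝ)) _ hmeas hint0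
      (fun j => Eventually.of_forall fun s => by rw [Real.norm_of_nonneg (hnn j s)]; exact hle j s)
      (Eventually.of_forall fun s => by
        have h1 : Tendsto (fun j => ‖aps d j s - s‖) atTop (𝓝 0) := by
          rw [← tendsto_iff_norm_sub_tendsto_zero]; exact aps_tendsto s
        simpa using (h1.mul_const (A * (1 + (2 * ‖s‖) ^ k))).const_mul ‖h s‖)
    simpa using this
  have key : ∀ j, SchwartzMap.seminorm ℂ k n (uj h φ j - cv h φ) ≤ B j := by
    intro j
    refine SchwartzMap.seminorm_le_bound ℂ k n _ (integral_nonneg (hnn j)) fun x => ?_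
    have e1 : iteratedFDeriv ℝ n (⇑(uj h φ j - cv h φ)) x = 
        iteratedFDeriv ℝ n (uj h φ j) x - iteratedFDeriv ℝ n (cv h φ) x := by
      have : (⇑(uj h φ j - cv h φ) : EuclideanSpace ℝ (Fin d) → ℂ) = ⇑(uj h φ j) - ⇑(cv h φ) := rfl
      rw [this, iteratedFDeriv_sub_apply]
      · exact ((uj h φ j).smooth n).contDiffAt
      · exact ((cv h φ).smooth n).contDiffAt
    rw [e1]
    by_cases hx : ‖x‖ ^ k = 0
    · rw [hx, zero_mul]; exact integral_nonneg (hnn j)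
    have hpos : 0 < ‖x‖ ^ k := lt_of_le_of_ne (by positivity) (Ne.symm hx)
    rw [mul_comm, ← le_div_iff₀ hpos]
    refine ContinuousMultilinearMap.opNorm_le_bound (div_nonneg (integral_nonneg (hnn j)) hpos.le) fun m => ?_
    rw [ContinuousMultilinearMap.sub_apply, uj_fderiv, iterFDeriv_cv, ← integral_sub
      (meas_aux h φ n x m _ (aps d j).measurable) (meas_aux h φ n x m (fun s => s) measurable_id)]
    have hi2 : Integrable (fun s => ‖h s‖ * (‖aps d j s - s‖ * (A * (1 + (2 * ‖s‖) ^ k))) / ‖x‖ ^ k * ∏ i, ‖m i‖) :=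
      ((hintg j).div_const _).mul_const _
    refine (norm_integral_le_of_norm_le hi2 (Eventually.of_forall fun s => ?_)).trans ?_
    · rw [← mul_sub, norm_mul, ← ContinuousMultilinearMap.sub_apply]
      have h1 := ContinuousMultilinearMap.le_opNorm (iteratedFDeriv ℝ n φ (x - aps d j s) - iteratedFDeriv ℝ n φ (x - s)) m
      have h2 := hb (2 * ‖s‖) (aps d j s) s x (aps_norm j s) (by linarith [norm_nonneg s])
      rw [mul_comm, ← le_div_iff₀ hpos] at h2
      calc _ ≤ ‖h s‖ * ((‖aps d j s - s‖ * (A * (1 + (2 * ‖s‖) ^ k)) / ‖x‖ ^ k) * ∏ i, ‖m i‖) := by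
            gcongr
            exact h1.trans (by gcongr)
        _ = _ := by ring
    · rw [integral_mul_const, integral_div]
  intro ε hε
  filter_upwards [hB.eventually (gt_mem_nhds hε)] with j hj
  exact (key j).trans_lt hj

lemma exch (T : 𝓢(EuclideanSpace ℝ (Fin d), ℂ) →L[ℂ] ℂ) (h φ : 𝓢(EuclideanSpace ℝ (Fin d), ℂ))
    (hc : Continuous (fun s => T (SchwartzMap.compSubConstCLM ℂ s φ))) {C : ℝ}
    (hC : ∀ s, ‖T (SchwartzMap.compSubConstCLM ℂ s φ)‖ ≤ C) :
    T (cv h φ) = ∫ s, h s * T (SchwartzMap.compSubConstCLM ℂ s φ) := by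
  have h1 : Tendsto (fun j => T (uj h φ j)) atTop (𝓝 (T (cv h φ))) :=
    (T.continuous.tendsto _).comp (uj_tendsto h φ)
  have h2 : ∀ j, T (uj h φ j) = ∫ s, h s * T (SchwartzMap.compSubConstCLM ℂ (aps d j s) φ) := by
    intro j
    rw [← simple_sum (aps d j) h.integrable (fun z => T (SchwartzMap.compSubConstCLM ℂ z φ)), uj, map_sum]
    simp only [map_smul, smul_eq_mul]
  refine tendsto_nhds_unique h1 ?_
  simp_rw [h2]
  refine tendsto_integral_of_dominated_convergence (fun s => ‖h s‖ * C) ?_ (h.integrable.norm.mul_const C) ?_ ?_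
  · intro j
    exact (h.continuous.measurable.mul (hc.measurable.comp (aps d j).measurable)).aestronglyMeasurable
  · intro j
    refine Eventually.of_forall fun s => ?_
    rw [norm_mul]
    exact mul_le_mul_of_nonneg_left (hC _) (norm_nonneg _)
  · exact Eventually.of_forall fun s => ((hc.tendsto s).comp (aps_tendsto s)).const_mul _

/-- reflected translate as a complex CLM -/
def trC (x : EuclideanSpace ℝ (Fin d)) : 𝓢(EuclideanSpace ℝ (Fin d), ℂ) →L[ℂ] 𝓢(EuclideanSpace ℝ (Fin d), ℂ) :=
  SchwartzMap.compCLMOfAntilipschitz (K := 1) ℂ (hasTemperateGrowth_const_sub x)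
    (isometry_const_sub x).antilipschitz

lemma trC_apply (x : EuclideanSpace ℝ (Fin d)) (ψ : 𝓢(EuclideanSpace ℝ (Fin d), ℂ)) :
    trC x ψ = transRefl x ψ := by ext y; rfl

lemma convTD_cv (T : 𝓢(EuclideanSpace ℝ (Fin d), ℂ) →L[ℂ] ℂ) (h φ : 𝓢(EuclideanSpace ℝ (Fin d), ℂ))
    (hc : Continuous (convTD T φ)) {C : ℝ} (hC : ∀ s, ‖convTD T φ s‖ ≤ C) (x : EuclideanSpace ℝ (Fin d)) :
    convTD T (cv h φ) x = ∫ s, h s * convTD T φ (x - s) := by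
  have e : ∀ s, (T.comp (trC x)) (SchwartzMap.compSubConstCLM ℂ s φ) = convTD T φ (x - s) := by
    intro s
    simp only [ContinuousLinearMap.comp_apply, trC_apply, convTD]
    congr 1
    ext y
    simp only [transRefl_apply, compSubConstCLM_apply]
    congr 1; abel
  have := exch (T.comp (trC x)) h φ (by simp_rw [e]; fun_prop) (C := C) (by simp_rw [e]; exact fun s => hC _)
  simp_rw [e] at this
  rw [← this, ContinuousLinearMap.comp_apply, trC_apply]; rfl
end Exch2

section Part8
open scoped FourierTransform ContDiff LineDeriv
variable {d : ℕ}

lemma HasMean.add' {f g : EuclideanSpace ℝ (Fin d) → ℂ} {m n : ℂ} (hf : HasMean f m) (hg : HasMean g n)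
    (hfc : Continuous f) (hgc : Continuous g) : HasMean (fun x => f x + g x) (m + n) := by
  unfold HasMean at *
  refine (Tendsto.add hf hg).congr fun R => ?_
  rw [integral_add (integrableOn_cube hfc R) (integrableOn_cube hgc R), smul_add]

lemma HasMean.const_mul' {f : EuclideanSpace ℝ (Fin d) → ℂ} {m : ℂ} (hf : HasMean f m) (c : ℂ) :
    HasMean (fun x => c * f x) (c * m) := by
  unfold HasMean at *
  refine (Tendsto.const_mul c hf).congr fun R => ?_
  rw [integral_const_mul, mul_smul_comm]

lemma hasMean_one : HasMean (fun _ : EuclideanSpace ℝ (Fin d) => (1:ℂ)) 1 := by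
  rw [hasMean_iff_avg]
  refine tendsto_const_nhds.congr' ?_
  filter_upwards [eventually_gt_atTop 0] with R hR
  rw [avg_const hR]

lemma hasMean_eChar {k : EuclideanSpace ℝ (Fin d)} (hk : k ≠ 0) : HasMean (eChar k) 0 := by
  rw [hasMean_iff_avg, tendsto_zero_iff_norm_tendsto_zero]
  refine squeeze_zero' (g := fun R => 1 * kap d (1 / (2 * ‖k‖)) R) (Eventually.of_forall fun _ => norm_nonneg _) ?_ ?_
  · filter_upwards [eventually_gt_atTop 0] with R hR
    have := avg_half_bound (f := fun _ => (1:ℂ)) continuous_const (C := 1) (by simp) k hk (η := 0) (by simp) hR 0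
    simp only [mul_one] at this
    have h2 := norm_nonneg (avg R (eChar k) 0)
    have h3 : avg R (fun x => eChar k x) 0 = avg R (eChar k) 0 := rfl
    rw [h3] at this
    linarith
  · simpa using (kap_tendsto (d := d) (1 / (2 * ‖k‖))).const_mul 1

lemma convTD_add (T : 𝓢(EuclideanSpace ℝ (Fin d), ℂ) →L[ℂ] ℂ) (φ ψ : 𝓢(EuclideanSpace ℝ (Fin d), ℂ)) (x) :
    convTD T (φ + ψ) x = convTD T φ x + convTD T ψ x := by
  simp only [convTD, ← trC_apply, map_add]

lemma convTD_smul (T : 𝓢(EuclideanSpace ℝ (Fin d), ℂ) →L[ℂ] ℂ) (c : ℂ) (ψ : 𝓢(EuclideanSpace ℝ (Fin d), ℂ)) (x) :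
    convTD T (c • ψ) x = c * convTD T ψ x := by
  simp only [convTD, ← trC_apply, map_smul, smul_eq_mul]

lemma contDiff_eChar (k : EuclideanSpace ℝ (Fin d)) : ContDiff ℝ ∞ (eChar k) := by
  unfold eChar
  have : ContDiff ℝ ∞ (fun x : EuclideanSpace ℝ (Fin d) => (-(2 * Real.pi * (inner ℝ x k : ℝ)) : ℝ)) :=
    (contDiff_const.mul (contDiff_id.inner ℝ contDiff_const)).neg
  exact ((Complex.ofRealCLM.contDiff.comp this).mul contDiff_const).cexp

/-- modulated test function -/
lemma exists_mod (k : EuclideanSpace ℝ (Fin d)) {ψ : 𝓢(EuclideanSpace ℝ (Fin d), ℂ)} (hψ : IsTestFn ψ) :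
    ∃ φ : 𝓢(EuclideanSpace ℝ (Fin d), ℂ), IsTestFn φ ∧ ∀ x, φ x = eChar k x * ψ x := by
  have hs : HasCompactSupport (fun x => eChar k x * ψ x) := HasCompactSupport.mul_left hψ
  have hd : ContDiff ℝ ∞ (fun x => eChar k x * ψ x) := (contDiff_eChar k).mul (ψ.smooth ⊤)
  exact ⟨hs.toSchwartzMap hd, hs, fun x => rfl⟩

lemma exists_bump (r : ℝ) (hr : 0 < r) : ∃ (φ : 𝓢(EuclideanSpace ℝ (Fin d), ℂ)) (g : EuclideanSpace ℝ (Fin d) → ℝ),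
    IsTestFn φ ∧ (∀ x, φ x = g x) ∧ (∀ x, 0 ≤ g x) ∧ (∀ x, r < ‖x‖ → g x = 0) ∧ Integrable g ∧ ∫ x, g x = 1 ∧ ∫ x, φ x = 1 := by
  let f : ContDiffBump (0 : EuclideanSpace ℝ (Fin d)) := ⟨r/2, r, by linarith, by linarith⟩
  set g := f.normed volume with hg
  have hgs : HasCompactSupport g := f.hasCompactSupport_normed
  have hs : HasCompactSupport (fun x => (g x : ℂ)) := hgs.comp_left Complex.ofReal_zero
  have hd : ContDiff ℝ ∞ (fun x => (g x : ℂ)) := Complex.ofRealCLM.contDiff.comp f.contDiff_normed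
  have h1 : ∫ x, g x = 1 := f.integral_normed
  refine ⟨hs.toSchwartzMap hd, g, hs, fun x => rfl, fun x => f.nonneg_normed x, fun x hx => ?_, f.integrable_normed, h1, ?_⟩
  · have : x ∉ Function.support g := by
      rw [hg, f.support_normed_eq]; simp [f]; exact hx.le
    simpa using this
  · have : ∫ x, ((g x : ℝ) : ℂ) = 1 := by rw [integral_complex_ofReal, h1]; simp
    exact this

lemma fourier_eChar (f : EuclideanSpace ℝ (Fin d) → ℂ) (k : EuclideanSpace ℝ (Fin d)) :
    𝓕 f k = ∫ x, eChar k x * f x := by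
  rw [Real.fourier_eq']
  refine integral_congr_ae (Eventually.of_forall fun x => ?_)
  simp only [eChar, smul_eq_mul]
  congr 2; push_cast; ring

lemma fourierInv_eChar (f : EuclideanSpace ℝ (Fin d) → ℂ) (k : EuclideanSpace ℝ (Fin d)) :
    𝓕⁻ f k = ∫ x, eChar (-k) x * f x := by
  rw [Real.fourierInv_eq']
  refine integral_congr_ae (Eventually.of_forall fun x => ?_)
  simp only [eChar, smul_eq_mul, inner_neg_right]
  congr 2; push_cast; ring

section
variable {T : 𝓢(EuclideanSpace ℝ (Fin d), ℂ) →L[ℂ] ℂ} {a : EuclideanSpace ℝ (Fin d) → ℂ}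

lemma mean_test (hSAP : SAPD T) 
    (ha : ∀ (k : EuclideanSpace ℝ (Fin d)) (φ ψ : SchwartzMap (EuclideanSpace ℝ (Fin d)) ℂ),
      IsTestFn φ → (∫ x, φ x) = 1 →
      (∀ x, ψ x = Complex.exp (((2 * Real.pi * (inner ℝ x k : ℝ) : ℝ) : ℂ) * Complex.I) * φ x) →
      HasMean (fun t => eChar k t * convTD T ψ t) (a k))
    (k : EuclideanSpace ℝ (Fin d)) {ψ : 𝓢(EuclideanSpace ℝ (Fin d), ℂ)} (hψ : IsTestFn ψ) :
    HasMean (fun t => eChar k t * convTD T ψ t) (a k * 𝓕 ψ k) := by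
  have hexp : ∀ x, Complex.exp (((2 * Real.pi * (inner ℝ x k : ℝ) : ℝ) : ℂ) * Complex.I) = eChar (-k) x := by
    intro x; simp [eChar, inner_neg_right]
  replace ha := ha k
  simp_rw [hexp] at ha
  have hinv : ∀ x, eChar (-k) x * eChar k x = 1 := fun x => by rw [← eChar_add_left]; simp
  obtain ⟨φ, hφ, hφe⟩ := exists_mod k hψ
  obtain ⟨φ0, -, hφ0, -, -, -, -, -, h1⟩ := exists_bump (d := d) 1 one_pos
  obtain ⟨ψ0, hψ0, hψe0⟩ := exists_mod (-k) hφ0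
  set c := 𝓕 ψ k with hc
  have hcφ : ∫ x, φ x = c := by
    rw [hc, SchwartzMap.fourier_coe, fourier_eChar]; simp_rw [hφe]
  have m0 := ha φ0 ψ0 hφ0 h1 hψe0
  have m1 := ha (φ + (1 - c) • φ0) (ψ + (1 - c) • ψ0) (hφ.add (HasCompactSupport.smul_left hφ0 (f := fun _ => (1 - c))))
    (by
      have : ∫ x, (φ + (1 - c) • φ0) x = (∫ x, φ x) + (1 - c) * ∫ x, φ0 x := by
        rw [← integral_const_mul, ← integral_add φ.integrable (φ0.integrable.const_mul _)]; rfl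
      rw [this, hcφ, h1]; ring) 
    (by
      intro x
      simp only [add_apply, smul_apply, smul_eq_mul, hφe, hψe0]
      have := hinv x
      linear_combination (-ψ x) * this)
  have hcont : ∀ u : 𝓢(EuclideanSpace ℝ (Fin d), ℂ), IsTestFn u → Continuous (fun t => eChar k t * convTD T u t) :=
    fun u hu => (continuous_eChar k).mul (hSAP u hu).1.continuous
  have ht1 : IsTestFn (ψ + (1 - c) • ψ0) := hψ.add (HasCompactSupport.smul_left hψ0 (f := fun _ => (1 - c)))
  have := m1.add' (m0.const_mul' (-(1 - c))) (hcont _ ht1) (continuous_const.mul (hcont _ hψ0))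
  convert this using 1
  · funext t
    rw [convTD_add, convTD_smul]; ring
  · ring

lemma gap_cv {h φ : 𝓢(EuclideanSpace ℝ (Fin d), ℂ)} (hF : GAP (convTD T φ)) : GAP (convTD T (cv h φ)) := by
  obtain ⟨C, hC⟩ := hF.bdd
  have hc := hF.uc.continuous
  have e := convTD_cv T h φ hc hC
  set H := (∫ s, ‖h s‖) + 1 with hH
  have hHn : 0 ≤ ∫ s, ‖h s‖ := integral_nonneg fun _ => norm_nonneg _
  have hHpos : 0 < H := by positivity
  have hi : ∀ x, Integrable (fun s => h s * convTD T φ (x - s)) := fun x =>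
    h.integrable.mul_bdd (c := C) (by fun_prop) (Eventually.of_forall fun s => hC _)
  have key : ∀ (x y : EuclideanSpace ℝ (Fin d)) (ε : ℝ), 0 < ε → (∀ s, ‖convTD T φ (x - s) - convTD T φ (y - s)‖ ≤ ε) →
      ‖convTD T (cv h φ) x - convTD T (cv h φ) y‖ < ε * H := by
    intro x y ε hε hs
    rw [e, e, ← integral_sub (hi x) (hi y)]
    have : ‖∫ s, (h s * convTD T φ (x - s) - h s * convTD T φ (y - s))‖ ≤ ∫ s, ‖h s‖ * ε := by
      refine norm_integral_le_of_norm_le (h.integrable.norm.mul_const ε) (Eventually.of_forall fun s => ?_)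
      rw [← mul_sub, norm_mul]
      exact mul_le_mul_of_nonneg_left (hs s) (norm_nonneg _)
    rw [integral_mul_const] at this
    rw [hH]; linarith
  refine ⟨?_, ⟨∫ s, ‖h s‖ * C, fun x => ?_⟩, fun ε hε => ?_⟩
  · rw [Metric.uniformContinuous_iff]
    intro ε hε
    obtain ⟨δ, hδ, hu⟩ := Metric.uniformContinuous_iff.1 hF.uc (ε / H) (by positivity)
    refine ⟨δ, hδ, fun {x y} hxy => ?_⟩
    rw [dist_eq_norm]
    have := key x y (ε / H) (by positivity) (fun s => by
      rw [← dist_eq_norm]; exact (hu (by simpa using hxy)).le)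
    rwa [div_mul_cancel₀ _ hHpos.ne'] at this
  · rw [e]
    refine norm_integral_le_of_norm_le (h.integrable.norm.mul_const C) (Eventually.of_forall fun s => ?_)
    rw [norm_mul]
    exact mul_le_mul_of_nonneg_left (hC _) (norm_nonneg _)
  · obtain ⟨s, hs⟩ := hF.tb (ε / H) (by positivity)
    refine ⟨s, fun t => ?_⟩
    obtain ⟨i, hi, hb⟩ := hs t
    refine ⟨i, hi, fun x => ?_⟩
    have := key (x + t) (x + i) (ε / H) (by positivity) (fun s => by
      have := (hb (x - s)).le
      rwa [sub_add_eq_add_sub, sub_add_eq_add_sub] at this)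
    rwa [div_mul_cancel₀ _ hHpos.ne'] at this

lemma mean_cv {h φ : 𝓢(EuclideanSpace ℝ (Fin d), ℂ)} (hF : GAP (convTD T φ)) {k : EuclideanSpace ℝ (Fin d)} {m : ℂ}
    (hm : HasMean (fun t => eChar k t * convTD T φ t) m) :
    HasMean (fun t => eChar k t * convTD T (cv h φ) t) (𝓕 h k * m) := by
  obtain ⟨C, hC⟩ := hF.bdd
  have hc := hF.uc.continuous
  have e := convTD_cv T h φ hc hC
  have hek := continuous_eChar (d := d) k
  set g : EuclideanSpace ℝ (Fin d) → ℂ := fun t => eChar k t * convTD T φ t with hg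
  have hgc : Continuous g := hek.mul hc
  have hgC : ∀ x, ‖g x‖ ≤ C := fun x => by rw [hg]; simpa using hC x
  have h1 : ∀ R, avg R (fun t => eChar k t * convTD T (cv h φ) t) 0 = ∫ s, (eChar k s * h s) * avg R g (-s) := by
    intro R
    have e2 : ∀ x, eChar k x * convTD T (cv h φ) x = ∫ s, (eChar k s * h s) * g (x - s) := by
      intro x
      rw [e, ← integral_const_mul]
      refine integral_congr_ae (Eventually.of_forall fun s => ?_)
      simp only [hg]
      have : eChar k x = eChar k s * eChar k (x - s) := by rw [← eChar_add]; congr 1; abel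
      rw [this]; ring
    simp only [avg, add_zero, e2]
    rw [integral_integral_swap]
    · rw [← integral_smul]
      refine integral_congr_ae (Eventually.of_forall fun s => ?_)
      simp only [integral_const_mul, mul_smul_comm, sub_eq_add_neg]
    · have : Integrable (fun p : EuclideanSpace ℝ (Fin d) × EuclideanSpace ℝ (Fin d) => (1:ℂ) * h p.2)
          ((volume.restrict (cube d R)).prod volume) := 
        Integrable.mul_prod (f := fun _ => (1:ℂ)) (integrableOn_const (volume_cube_lt_top R).ne) h.integrable
      have h3 : Continuous (fun p : EuclideanSpace ℝ (Fin d) × EuclideanSpace ℝ (Fin d) => eChar k p.2 * g (p.1 - p.2)) := by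
        fun_prop
      refine (this.mul_bdd (c := C) h3.aestronglyMeasurable (Eventually.of_forall fun p => ?_)).congr (Eventually.of_forall fun p => ?_)
      · rw [norm_mul, norm_eChar, one_mul]; exact hgC _
      · simp only [Function.uncurry]; ring
  rw [hasMean_iff_avg]
  simp_rw [h1]
  have h2 : 𝓕 h k * m = ∫ s, (eChar k s * h s) * m := by
    rw [integral_mul_const, SchwartzMap.fourier_coe, fourier_eChar]
  rw [h2]
  refine tendsto_integral_filter_of_dominated_convergence (fun s => ‖h s‖ * C) ?_ ?_ (h.integrable.norm.mul_const C) ?_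
  · refine Eventually.of_forall fun R => ?_
    have := continuous_avg R hgc
    have := h.continuous
    exact Continuous.aestronglyMeasurable (by fun_prop)
  · filter_upwards [eventually_gt_atTop 0] with R hR
    refine Eventually.of_forall fun s => ?_
    rw [norm_mul, norm_mul, norm_eChar, one_mul]
    gcongr
    exact norm_avg_le hR fun x _ => hgC _
  · exact Eventually.of_forall fun s => (hm.avg_tendsto hgc hgC (-s)).const_mul _
end
end Part8

section Part9
open scoped FourierTransform ContDiff LineDeriv
variable {d : ℕ}

lemma exists_factor {η : 𝓢(EuclideanSpace ℝ (Fin d), ℂ)} (hη : IsTestFn η) :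
    ∃ h φ : 𝓢(EuclideanSpace ℝ (Fin d), ℂ), IsTestFn φ ∧ 𝓕⁻ η = cv h φ := by
  obtain ⟨r0, hr0⟩ := (IsCompact.isBounded (show IsCompact (tsupport η) from hη)).exists_norm_le
  set r := max r0 1 with hr
  have hrpos : 0 < r := lt_of_lt_of_le one_pos (le_max_right _ _)
  have hsub : ∀ k ∈ tsupport η, ‖k‖ ≤ r := fun k hk => (hr0 k hk).trans (le_max_left _ _)
  set ρ := 1 / (4 * Real.pi * r) with hρ
  have hpi := Real.pi_pos
  have hρpos : 0 < ρ := by positivity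
  obtain ⟨φ, g, hφ, hφg, hg0, hgs, hgi, hg1, hφ1⟩ := exists_bump (d := d) ρ hρpos
  have hne : ∀ k ∈ tsupport η, 𝓕 φ k ≠ 0 := by
    intro k hk h0
    have e0 : (𝓕 φ k) - ∫ x, φ x = ∫ x, (eChar k x - 1) * φ x := by
      rw [SchwartzMap.fourier_coe, fourier_eChar, ← integral_sub]
      · simp_rw [sub_mul, one_mul]
      · exact φ.integrable.bdd_mul (c := 1) (continuous_eChar k).aestronglyMeasurable (Eventually.of_forall fun x => by simp)
      · exact φ.integrable
    have e1 : (𝓕 φ k) - 1 = ∫ x, (eChar k x - 1) * φ x := by rw [← e0, hφ1]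
    have e2 : ‖(𝓕 φ k) - 1‖ ≤ ∫ x, (1/2) * g x := by
      rw [e1]
      refine norm_integral_le_of_norm_le (hgi.const_mul _) (Eventually.of_forall fun x => ?_)
      rw [norm_mul, hφg, Complex.norm_real, Real.norm_of_nonneg (hg0 x)]
      by_cases hx : ρ < ‖x‖
      · rw [hgs x hx]; simp
      push Not at hx
      refine mul_le_mul_of_nonneg_right ?_ (hg0 x)
      have h1 := norm_eChar_sub_le k 0 x
      rw [eChar_zero_left, sub_zero] at h1
      have h2 := hsub k hk
      calc ‖eChar k x - 1‖ ≤ 2 * Real.pi * ‖x‖ * ‖k‖ := h1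
        _ ≤ 2 * Real.pi * ρ * r := by gcongr
        _ = 1 / 2 := by rw [hρ]; field_simp; norm_num
    rw [integral_const_mul, hg1, h0] at e2
    norm_num at e2
  have hsupp : HasCompactSupport (fun k => η k * (𝓕 φ k)⁻¹) := HasCompactSupport.mul_right hη
  have hd : ContDiff ℝ ∞ (fun k => η k * (𝓕 φ k)⁻¹) := by
    rw [contDiff_iff_contDiffAt]
    intro k
    by_cases hk : k ∈ tsupport η
    · exact (η.smooth ⊤).contDiffAt.mul (((𝓕 φ).smooth ⊤).contDiffAt.inv (hne k hk))
    · have : (fun k => η k * (𝓕 φ k)⁻¹) =ᶠ[𝓝 k] fun _ => 0 := by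
        filter_upwards [notMem_tsupport_iff_eventuallyEq.1 hk] with y hy
        simp [hy]
      exact contDiffAt_const.congr_of_eventuallyEq this
  set q := hsupp.toSchwartzMap hd
  have hq : ∀ k, q k = η k * (𝓕 φ k)⁻¹ := fun k => rfl
  refine ⟨𝓕⁻ q, φ, hφ, fourier_inj ?_⟩
  ext k
  rw [fourier_cv]
  simp only [FourierTransform.fourier_fourierInv_eq, hq]
  by_cases hk : k ∈ tsupport η
  · rw [mul_assoc, inv_mul_cancel₀ (hne k hk), mul_one]
  · simp [image_eq_zero_of_notMem_tsupport hk]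

section
variable {T : 𝓢(EuclideanSpace ℝ (Fin d), ℂ) →L[ℂ] ℂ} {a : EuclideanSpace ℝ (Fin d) → ℂ}

lemma gap_inv (hSAP : SAPD T) {η : 𝓢(EuclideanSpace ℝ (Fin d), ℂ)} (hη : IsTestFn η) :
    GAP (convTD T (𝓕⁻ η)) := by
  obtain ⟨h, φ, hφ, e⟩ := exists_factor hη
  rw [e]; exact gap_cv (GAP.of_bohr (hSAP φ hφ))

lemma mean_inv (hSAP : SAPD T) 
    (ha : ∀ (k : EuclideanSpace ℝ (Fin d)) (φ ψ : SchwartzMap (EuclideanSpace ℝ (Fin d)) ℂ),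
      IsTestFn φ → (∫ x, φ x) = 1 →
      (∀ x, ψ x = Complex.exp (((2 * Real.pi * (inner ℝ x k : ℝ) : ℝ) : ℂ) * Complex.I) * φ x) →
      HasMean (fun t => eChar k t * convTD T ψ t) (a k))
    (k : EuclideanSpace ℝ (Fin d)) {η : 𝓢(EuclideanSpace ℝ (Fin d), ℂ)} (hη : IsTestFn η) :
    HasMean (fun t => eChar k t * convTD T (𝓕⁻ η) t) (a k * η k) := by
  obtain ⟨h, φ, hφ, e⟩ := exists_factor hη
  have h1 : η k = 𝓕 h k * 𝓕 φ k := by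
    rw [← fourier_cv, ← e, FourierTransform.fourier_fourierInv_eq]
  have := mean_cv (h := h) (GAP.of_bohr (hSAP φ hφ)) (mean_test hSAP ha k hφ)
  rw [e, h1]
  convert this using 1
  ring

lemma convTD_inv {η ηx : 𝓢(EuclideanSpace ℝ (Fin d), ℂ)} (x : EuclideanSpace ℝ (Fin d))
    (hx : ∀ k, ηx k = eChar (-x) k * η k) : convTD T (𝓕⁻ η) x = fourierTD T ηx := by
  rw [fourierTD, ContinuousLinearMap.comp_apply, convTD]
  congr 1
  ext y
  rw [transRefl_apply, SchwartzMap.fourierTransformCLM_apply, SchwartzMap.fourier_coe, SchwartzMap.fourierInv_coe,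
    fourier_eChar, fourierInv_eChar]
  refine integral_congr_ae (Eventually.of_forall fun ξ => ?_)
  simp only [hx]
  rw [← mul_assoc, ← eChar_add_left]
  congr 2; abel

lemma convTD_inv_zero (η : 𝓢(EuclideanSpace ℝ (Fin d), ℂ)) : convTD T (𝓕⁻ η) 0 = fourierTD T η :=
  convTD_inv 0 (by simp)
end

/-- absolutely convergent exponential series -/
lemma series_gap {f : EuclideanSpace ℝ (Fin d) → ℂ} (hf : Summable f) :
    GAP (fun x => ∑' k, f k * eChar (-k) x) ∧ ∀ l, HasMean (fun x => eChar l x * ∑' k, f k * eChar (-k) x) (f l) := by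
  classical
  have hn : Summable (fun k => ‖f k‖) := hf.norm
  have hs : ∀ x, Summable (fun k => f k * eChar (-k) x) := fun x => by
    apply Summable.of_norm; simpa using hn
  have happ : ∀ ε > 0, ∃ s : Finset (EuclideanSpace ℝ (Fin d)), ∀ s', s ⊆ s' → ∀ x,
      ‖(∑' k, f k * eChar (-k) x) - ∑ k ∈ s', f k * eChar (-k) x‖ ≤ ε := by
    intro ε hε
    obtain ⟨s, hsε⟩ := (Metric.tendsto_atTop.1 hn.hasSum ε hε)
    refine ⟨s, fun s' hs' x => ?_⟩
    have h1 := hsε s' hs'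
    rw [← (hs x).sum_add_tsum_subtype_compl s', add_sub_cancel_left]
    have h2 := hn.sum_add_tsum_subtype_compl s'
    have h3 : Summable (fun k : {k // k ∉ s'} => ‖f k * eChar (-(k : EuclideanSpace ℝ (Fin d))) x‖) := by
      simp only [norm_mul, norm_eChar, mul_one]; exact hn.subtype _
    refine (norm_tsum_le_tsum_norm h3).trans ?_
    simp only [norm_mul, norm_eChar, mul_one]
    rw [dist_comm, Real.dist_eq] at h1
    have := le_abs_self ((∑' k, ‖f k‖) - ∑ k ∈ s', ‖f k‖)
    linarith
  have hgs : ∀ s : Finset (EuclideanSpace ℝ (Fin d)), GAP (fun x => ∑ k ∈ s, f k * eChar (-k) x) := fun s =>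
    GAP.sum s _ fun k _ => (GAP.eChar (-k)).const_mul _
  have hG : GAP (fun x => ∑' k, f k * eChar (-k) x) := by
    refine GAP.of_approx fun ε hε => ?_
    obtain ⟨s, h⟩ := happ ε hε
    exact ⟨_, hgs s, h s subset_rfl⟩
  refine ⟨hG, fun l => ?_⟩
  have hms : ∀ s : Finset (EuclideanSpace ℝ (Fin d)), HasMean (fun x => eChar l x * ∑ k ∈ s, f k * eChar (-k) x)
      (if l ∈ s then f l else 0) := by
    intro s
    induction s using Finset.induction_on with
    | empty => 
      simp only [Finset.sum_empty, mul_zero, Finset.notMem_empty, if_false]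
      simpa using hasMean_one.const_mul' (d := d) 0
    | insert k s hk ih =>
      have h1 : HasMean (fun x => f k * eChar (l - k) x) (if l = k then f l else 0) := by
        by_cases hlk : l = k
        · subst hlk
          simpa using hasMean_one.const_mul' (d := d) (f l)
        · simpa [hlk] using (hasMean_eChar (sub_ne_zero.2 hlk)).const_mul' (f k)
      have h2 := h1.add' ih (continuous_const.mul (continuous_eChar _))
        ((continuous_eChar l).mul (hgs s).uc.continuous)
      convert h2 using 1
      · funext x
        rw [Finset.sum_insert hk, sub_eq_add_neg, eChar_add_left]; ring
      · by_cases hlk : l = k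
        · subst hlk; simp [hk]
        · simp [hlk]
  rw [hasMean_iff_avg, Metric.tendsto_atTop']
  intro ε hε
  obtain ⟨s, h⟩ := happ (ε / 2) (by linarith)
  have h1 := h (insert l s) (Finset.subset_insert _ _)
  have h2 := hms (insert l s)
  rw [if_pos (Finset.mem_insert_self _ _), hasMean_iff_avg, Metric.tendsto_atTop'] at h2
  obtain ⟨R0, hR0⟩ := h2 (ε / 2) (by linarith)
  refine ⟨max R0 0, fun R hR => ?_⟩
  have h3 := hR0 R ((le_max_left _ _).trans_lt hR)
  have hRpos : 0 < R := (le_max_right _ _).trans_lt hR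
  have h4 := norm_avg_sub_avg_le hRpos (t := 0) (s := 0) ((continuous_eChar l).mul hG.uc.continuous)
    ((continuous_eChar l).mul (hgs (insert l s)).uc.continuous) (C := ε / 2) (fun x _ => by
      simp only [Pi.mul_apply, add_zero]
      rw [← mul_sub, norm_mul, norm_eChar, one_mul]
      exact h1 x)
  rw [← dist_eq_norm] at h4
  calc _ ≤ _ := dist_triangle _ _ _
    _ < ε / 2 + ε / 2 := add_lt_add_of_le_of_lt h4 h3
    _ = ε := by ring
end Part9

section Part10
open scoped FourierTransform ContDiff LineDeriv
variable {d : ℕ}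

section
variable {T : 𝓢(EuclideanSpace ℝ (Fin d), ℂ) →L[ℂ] ℂ} {a : EuclideanSpace ℝ (Fin d) → ℂ}

lemma formula (hSAP : SAPD T) 
    (ha : ∀ (k : EuclideanSpace ℝ (Fin d)) (φ ψ : SchwartzMap (EuclideanSpace ℝ (Fin d)) ℂ),
      IsTestFn φ → (∫ x, φ x) = 1 →
      (∀ x, ψ x = Complex.exp (((2 * Real.pi * (inner ℝ x k : ℝ) : ℝ) : ℂ) * Complex.I) * φ x) →
      HasMean (fun t => eChar k t * convTD T ψ t) (a k))
    {η : 𝓢(EuclideanSpace ℝ (Fin d), ℂ)} (hη : IsTestFn η) (hs : Summable (fun k => a k * η k)) :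
    fourierTD T η = ∑' k, a k * η k := by
  obtain ⟨hP, hPm⟩ := series_gap hs
  have hG := gap_inv hSAP hη
  have hD : GAP (fun x => convTD T (𝓕⁻ η) x + (-1) * ∑' k, a k * η k * eChar (-k) x) := hG.add (hP.const_mul (-1))
  have h0 := hD.eq_zero (fun k => by
    have := (mean_inv hSAP ha k hη).add' ((hPm k).const_mul' (-1)) ((continuous_eChar k).mul hG.uc.continuous)
      (continuous_const.mul ((continuous_eChar k).mul hP.uc.continuous))
    convert this using 1
    · funext x; ring
    · ring) 0
  rw [convTD_inv_zero] at h0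
  simp only [eChar_zero, mul_one] at h0
  linear_combination h0

lemma summable_of_ii (hii : ∀ K : Set (EuclideanSpace ℝ (Fin d)), IsCompact K →
        Summable (fun k : ↥({k : EuclideanSpace ℝ (Fin d) | a k ≠ 0} ∩ K) => ‖a (k : EuclideanSpace ℝ (Fin d))‖))
    {η : 𝓢(EuclideanSpace ℝ (Fin d), ℂ)} (hη : IsTestFn η) : Summable (fun k => a k * η k) := by
  have h1 := hii (tsupport η) hη
  have h2 : Summable (({k : EuclideanSpace ℝ (Fin d) | a k ≠ 0} ∩ tsupport η).indicator fun k => ‖a k‖) :=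
    summable_subtype_iff_indicator.1 h1
  have h3 := h2.mul_right (SchwartzMap.seminorm ℝ 0 0 η)
  refine Summable.of_norm_bounded h3 fun k => ?_
  rw [norm_mul]
  by_cases hk : k ∈ ({k : EuclideanSpace ℝ (Fin d) | a k ≠ 0} ∩ tsupport η)
  · rw [Set.indicator_of_mem hk]
    exact mul_le_mul_of_nonneg_left (η.norm_le_seminorm ℝ k) (norm_nonneg _)
  · rw [Set.indicator_of_notMem hk, zero_mul]
    by_cases hak : a k = 0
    · simp [hak]
    · have : k ∉ tsupport η := fun h => hk ⟨hak, h⟩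
      simp [image_eq_zero_of_notMem_tsupport this]
end

lemma conj_eChar (k x : EuclideanSpace ℝ (Fin d)) : conj (eChar k x) = eChar (-k) x := by
  unfold eChar
  rw [← Complex.exp_conj]
  congr 1
  rw [map_mul, Complex.conj_I, Complex.conj_ofReal, inner_neg_right]
  push_cast
  ring

lemma trig_norm_sq (s : Finset (EuclideanSpace ℝ (Fin d))) (c : EuclideanSpace ℝ (Fin d) → ℂ) :
    HasMean (fun x => ((‖∑ k ∈ s, c k * eChar k x‖ ^ 2 : ℝ) : ℂ)) (∑ k ∈ s, ((‖c k‖ ^ 2 : ℝ) : ℂ)) := by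
  classical
  have h1 : ∀ x, ((‖∑ k ∈ s, c k * eChar k x‖ ^ 2 : ℝ) : ℂ) = ∑ k ∈ s, ∑ l ∈ s, (c k * conj (c l)) * eChar (k - l) x := by
    intro x
    have : ((‖∑ k ∈ s, c k * eChar k x‖ ^ 2 : ℝ) : ℂ) = (∑ k ∈ s, c k * eChar k x) * conj (∑ k ∈ s, c k * eChar k x) := by
      rw [Complex.mul_conj, Complex.normSq_eq_norm_sq]
    rw [this, map_sum, Finset.sum_mul_sum]
    refine Finset.sum_congr rfl fun k _ => Finset.sum_congr rfl fun l _ => ?_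
    rw [map_mul, conj_eChar, sub_eq_add_neg, eChar_add_left]; ring
  have hsum : ∀ (t : Finset (EuclideanSpace ℝ (Fin d))) (F : EuclideanSpace ℝ (Fin d) → EuclideanSpace ℝ (Fin d) → ℂ) (m : EuclideanSpace ℝ (Fin d) → ℂ),
      (∀ k, Continuous (F k)) → (∀ k ∈ t, HasMean (F k) (m k)) → HasMean (fun x => ∑ k ∈ t, F k x) (∑ k ∈ t, m k) := by
    intro t F m hc hm
    induction t using Finset.induction_on with
    | empty => simpa using hasMean_one.const_mul' (d := d) 0
    | insert k t hk ih =>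
      simp only [Finset.sum_insert hk]
      exact (hm k (Finset.mem_insert_self _ _)).add' (ih fun l hl => hm l (Finset.mem_insert_of_mem hl)) (hc k)
        (continuous_finsetSum _ fun l _ => hc l)
  simp_rw [h1]
  refine hsum s _ _ (fun k => continuous_finsetSum _ fun l _ => continuous_const.mul (continuous_eChar _)) fun k hk => ?_
  have h2 := hsum s (fun l x => (c k * conj (c l)) * eChar (k - l) x) (fun l => if l = k then ((‖c k‖ ^ 2 : ℝ) : ℂ) else 0)
    (fun l => continuous_const.mul (continuous_eChar _)) (fun l _ => by
      by_cases hlk : l = k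
      · subst hlk
        have : ((‖c l‖ ^ 2 : ℝ) : ℂ) = c l * conj (c l) := by rw [Complex.mul_conj, Complex.normSq_eq_norm_sq]
        rw [if_pos rfl, this]
        simpa using hasMean_one.const_mul' (d := d) (c l * conj (c l))
      · rw [if_neg hlk]
        simpa using (hasMean_eChar (sub_ne_zero.2 (Ne.symm hlk))).const_mul' (c k * conj (c l)))
  simpa [hk] using h2

lemma bessel {G : EuclideanSpace ℝ (Fin d) → ℂ} (hc : Continuous G) {C : ℝ} (hC : ∀ x, ‖G x‖ ≤ C)
    {f : EuclideanSpace ℝ (Fin d) → ℂ} (hf : ∀ k, HasMean (fun x => eChar k x * G x) (f k)) 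
    (s : Finset (EuclideanSpace ℝ (Fin d))) : ∑ k ∈ s, ‖f k‖ ^ 2 ≤ C ^ 2 := by
  classical
  set H : EuclideanSpace ℝ (Fin d) → ℂ := fun x => ∑ k ∈ s, conj (f k) * eChar k x with hH
  have hHc : Continuous H := continuous_finsetSum _ fun k _ => continuous_const.mul (continuous_eChar k)
  have h1 : HasMean (fun x => H x * G x) (∑ k ∈ s, ((‖f k‖ ^ 2 : ℝ) : ℂ)) := by
    have : ∀ t : Finset (EuclideanSpace ℝ (Fin d)), HasMean (fun x => (∑ k ∈ t, conj (f k) * eChar k x) * G x) (∑ k ∈ t, ((‖f k‖ ^ 2 : ℝ) : ℂ)) := by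
      intro t
      induction t using Finset.induction_on with
      | empty => simpa using hasMean_one.const_mul' (d := d) 0
      | insert k t hk ih =>
        have e1 : ((‖f k‖ ^ 2 : ℝ) : ℂ) = conj (f k) * f k := by
          rw [mul_comm, Complex.mul_conj, Complex.normSq_eq_norm_sq]
        have := ((hf k).const_mul' (conj (f k))).add' ih (continuous_const.mul ((continuous_eChar k).mul hc))
          ((continuous_finsetSum _ fun k _ => continuous_const.mul (continuous_eChar k)).mul hc)
        rw [Finset.sum_insert hk, e1]
        convert this using 1
        funext x
        rw [Finset.sum_insert hk]; ring
    exact this s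
  have h2 : HasMean (fun x => ((‖H x‖ ^ 2 : ℝ) : ℂ)) (∑ k ∈ s, ((‖f k‖ ^ 2 : ℝ) : ℂ)) := by
    have := trig_norm_sq s (fun k => conj (f k))
    simpa using this
  have h3 := ((hasMean_one (d := d)).const_mul' ((C ^ 2 : ℝ) : ℂ)).add' h2 (by fun_prop) (by fun_prop)
  set Q : ℝ := ∑ k ∈ s, ‖f k‖ ^ 2 with hQ
  have hQ' : ∑ k ∈ s, ((‖f k‖ ^ 2 : ℝ) : ℂ) = (Q : ℂ) := by rw [hQ]; push_cast; rfl
  have hQ0 : 0 ≤ Q := Finset.sum_nonneg fun _ _ => by positivity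
  rw [hQ'] at h1 h3
  unfold HasMean at h1 h3
  have h4 := h1.norm.const_mul 2
  have h5 := h3.norm
  have h6 : 2 * ‖(Q : ℂ)‖ ≤ ‖((C ^ 2 : ℝ) : ℂ) * 1 + (Q : ℂ)‖ := by
    refine le_of_tendsto_of_tendsto h4 h5 ?_
    filter_upwards [eventually_gt_atTop 0] with R hR
    rw [norm_smul, norm_smul, mul_left_comm]
    refine mul_le_mul_of_nonneg_left ?_ (norm_nonneg _)
    have e1 : ∫ x in cube d R, (((C ^ 2 : ℝ) : ℂ) * 1 + ((‖H x‖ ^ 2 : ℝ) : ℂ)) = ((∫ x in cube d R, (C ^ 2 + ‖H x‖ ^ 2) : ℝ) : ℂ) := by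
      rw [← integral_complex_ofReal]; simp
    have hnn : 0 ≤ ∫ x in cube d R, (C ^ 2 + ‖H x‖ ^ 2) := integral_nonneg fun x => by positivity
    rw [e1, Complex.norm_real, Real.norm_of_nonneg hnn]
    have hintg : IntegrableOn (fun x => (C ^ 2 + ‖H x‖ ^ 2) / 2) (cube d R) :=
      (by fun_prop : Continuous (fun x => (C ^ 2 + ‖H x‖ ^ 2) / 2)).continuousOn.integrableOn_compact (isCompact_cube R)
    have := norm_integral_le_of_norm_le (f := fun x => H x * G x) hintg (Eventually.of_forall fun x => by
      rw [norm_mul]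
      have h1 := hC x
      have h2 := norm_nonneg (H x)
      have h3 := norm_nonneg (G x)
      nlinarith [sq_nonneg (‖H x‖ - C)])
    rw [integral_div] at this
    linarith
  rw [mul_one, ← Complex.ofReal_add, Complex.norm_real, Complex.norm_real, Real.norm_of_nonneg hQ0, Real.norm_of_nonneg (by positivity)] at h6
  linarith

/-- test function equal to one on a ball -/
lemma exists_cutoff (r : ℝ) : ∃ η : 𝓢(EuclideanSpace ℝ (Fin d), ℂ), IsTestFn η ∧ ∀ k, ‖k‖ ≤ r → η k = 1 := by
  set ρ := max r 0 + 1
  have hρ : 0 < ρ := by positivity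
  let f : ContDiffBump (0 : EuclideanSpace ℝ (Fin d)) := ⟨ρ, ρ + 1, hρ, by linarith⟩
  have hs : HasCompactSupport (fun x => (f x : ℂ)) := f.hasCompactSupport.comp_left Complex.ofReal_zero
  have hd : ContDiff ℝ ∞ (fun x => (f x : ℂ)) := Complex.ofRealCLM.contDiff.comp f.contDiff
  refine ⟨hs.toSchwartzMap hd, hs, fun k hk => ?_⟩
  have : f k = 1 := f.one_of_mem_closedBall (by
    simp only [mem_closedBall, dist_zero_right]
    have := le_max_left r 0
    change ‖k‖ ≤ ρ
    linarith)
  change ((f k : ℝ) : ℂ) = 1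
  rw [this]; simp

section
variable {T : 𝓢(EuclideanSpace ℝ (Fin d), ℂ) →L[ℂ] ℂ} {a : EuclideanSpace ℝ (Fin d) → ℂ}

lemma countable_S (hSAP : SAPD T) 
    (ha : ∀ (k : EuclideanSpace ℝ (Fin d)) (φ ψ : SchwartzMap (EuclideanSpace ℝ (Fin d)) ℂ),
      IsTestFn φ → (∫ x, φ x) = 1 →
      (∀ x, ψ x = Complex.exp (((2 * Real.pi * (inner ℝ x k : ℝ) : ℝ) : ℂ) * Complex.I) * φ x) →
      HasMean (fun t => eChar k t * convTD T ψ t) (a k)) :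
    {k : EuclideanSpace ℝ (Fin d) | a k ≠ 0}.Countable := by
  choose η hη h1 using fun n : ℕ => exists_cutoff (d := d) n
  refine (Set.countable_iUnion fun n : ℕ => ?_ : (⋃ n : ℕ, {k | a k * η n k ≠ 0}).Countable).mono ?_
  · have hG := gap_inv hSAP (hη n)
    obtain ⟨C, hC⟩ := hG.bdd
    have hb := bessel hG.uc.continuous hC (fun k => mean_inv hSAP ha k (hη n))
    have hs : Summable (fun k => ‖a k * η n k‖ ^ 2) := summable_of_sum_le (fun _ => by positivity) hb
    refine hs.countable_support.mono fun k hk => ?_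
    simp only [Function.mem_support]
    have : a k * η n k ≠ 0 := hk
    positivity
  · intro k hk
    obtain ⟨n, hn⟩ := exists_nat_ge ‖k‖
    refine Set.mem_iUnion.2 ⟨n, ?_⟩
    change a k * η n k ≠ 0
    rw [h1 n k hn, mul_one]; exact hk

lemma integrable_pair (μ : CMeasure (EuclideanSpace ℝ (Fin d))) {η : 𝓢(EuclideanSpace ℝ (Fin d), ℂ)} (hη : IsTestFn η) :
    Integrable (fun x => η x * μ.density x) μ.tv := by
  have := μ.locFin
  refine (η.continuous.integrable_of_hasCompactSupport hη).mul_bdd (c := 1) μ.density_meas.aestronglyMeasurable ?_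
  filter_upwards [μ.density_norm] with x hx
  rw [hx]

lemma continuous_eChar_pair (k : EuclideanSpace ℝ (Fin d)) :
    Continuous (fun p : EuclideanSpace ℝ (Fin d) × EuclideanSpace ℝ (Fin d) => eChar (k - p.2) p.1) := by
  unfold eChar; fun_prop

lemma continuous_avg_eChar (k : EuclideanSpace ℝ (Fin d)) (R : ℝ) :
    Continuous (fun ξ => avg R (eChar (k - ξ)) (0 : EuclideanSpace ℝ (Fin d))) := by
  unfold avg
  simp only [add_zero]
  have h0 : Continuous (Function.uncurry (fun ξ x : EuclideanSpace ℝ (Fin d) => eChar (k - ξ) x)) :=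
    by unfold eChar; simp only [Function.uncurry_def]; fun_prop
  have : Continuous (fun ξ => ∫ x in cube d R, eChar (k - ξ) x) :=
    continuous_parametric_integral_of_continuous h0 (isCompact_cube R)
  exact Continuous.const_smul (M := ℝ) this _

lemma lim_pair (ν : Measure (EuclideanSpace ℝ (Fin d))) {w : EuclideanSpace ℝ (Fin d) → ℂ}
    (hwi : Integrable w ν) (k : EuclideanSpace ℝ (Fin d)) :
    Tendsto (fun R => ∫ ξ, w ξ * avg R (eChar (k - ξ)) 0 ∂ν) atTop
      (𝓝 (∫ ξ, ({k} : Set (EuclideanSpace ℝ (Fin d))).indicator w ξ ∂ν)) := by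
  refine tendsto_integral_filter_of_dominated_convergence (fun ξ => ‖w ξ‖) ?_ ?_ hwi.norm ?_
  · refine Eventually.of_forall fun R => ?_
    exact hwi.aestronglyMeasurable.mul (continuous_avg_eChar k R).aestronglyMeasurable
  · filter_upwards [eventually_gt_atTop 0] with R hR
    refine Eventually.of_forall fun ξ => ?_
    rw [norm_mul]
    exact mul_le_of_le_one_right (norm_nonneg _) (norm_avg_le hR fun x _ => by simp)
  · refine Eventually.of_forall fun ξ => ?_
    by_cases hξ : ξ = k
    · subst hξ
      have h2 := (hasMean_iff_avg _ _).1 (hasMean_one (d := d))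
      have e3 : (eChar (ξ - ξ) : EuclideanSpace ℝ (Fin d) → ℂ) = fun _ => 1 := by funext x; simp
      simp only [e3]
      simpa using h2.const_mul (w ξ)
    · have h2 := (hasMean_iff_avg _ _).1 (hasMean_eChar (sub_ne_zero.2 (Ne.symm hξ)))
      simpa [hξ] using h2.const_mul (w ξ)

lemma fubini_pair (ν : Measure (EuclideanSpace ℝ (Fin d))) [SFinite ν] {w : EuclideanSpace ℝ (Fin d) → ℂ}
    (hwi : Integrable w ν) (k : EuclideanSpace ℝ (Fin d)) (R : ℝ) :
    avg R (fun t => ∫ ξ, w ξ * eChar (k - ξ) t ∂ν) 0 = ∫ ξ, w ξ * avg R (eChar (k - ξ)) 0 ∂ν := by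
  simp only [avg, add_zero]
  rw [integral_integral_swap]
  · rw [← integral_smul]
    refine integral_congr_ae (Eventually.of_forall fun s => ?_)
    simp only [integral_const_mul, mul_smul_comm]
  · have : Integrable (fun p : EuclideanSpace ℝ (Fin d) × EuclideanSpace ℝ (Fin d) => (1:ℂ) * w p.2)
        ((volume.restrict (cube d R)).prod ν) := 
      Integrable.mul_prod (f := fun _ => (1:ℂ)) (integrableOn_const (volume_cube_lt_top R).ne) hwi
    refine (this.mul_bdd (c := 1) (continuous_eChar_pair k).aestronglyMeasurable (Eventually.of_forall fun p => by simp)).congr (Eventually.of_forall fun p => ?_)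
    simp only [Function.uncurry]; ring

lemma coeff_of_measure (hSAP : SAPD T) 
    (ha : ∀ (k : EuclideanSpace ℝ (Fin d)) (φ ψ : SchwartzMap (EuclideanSpace ℝ (Fin d)) ℂ),
      IsTestFn φ → (∫ x, φ x) = 1 →
      (∀ x, ψ x = Complex.exp (((2 * Real.pi * (inner ℝ x k : ℝ) : ℝ) : ℂ) * Complex.I) * φ x) →
      HasMean (fun t => eChar k t * convTD T ψ t) (a k))
    (μ : CMeasure (EuclideanSpace ℝ (Fin d))) (hμ : μ.Agrees (fourierTD T)) (k : EuclideanSpace ℝ (Fin d)) :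
    ‖a k‖ ≤ μ.tv.real {k} := by
  classical
  have := μ.locFin
  obtain ⟨η, hη, h1⟩ := exists_cutoff (d := d) ‖k‖
  have hηk := h1 k le_rfl
  have hm := mean_inv hSAP ha k hη
  rw [hηk, mul_one, hasMean_iff_avg] at hm
  obtain ⟨w, hw⟩ : ∃ w : EuclideanSpace ℝ (Fin d) → ℂ, w = fun x => η x * μ.density x := ⟨_, rfl⟩
  have hwi : Integrable w μ.tv := hw ▸ integrable_pair μ hη
  have e1 : ∀ x, eChar k x * convTD T (𝓕⁻ η) x = ∫ ξ, w ξ * eChar (k - ξ) x ∂μ.tv := by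
    intro x
    obtain ⟨ηx, hηx, hx⟩ := exists_mod (-x) hη
    rw [convTD_inv x hx, hμ ηx hηx, CMeasure.pairing, ← integral_const_mul]
    refine integral_congr_ae (Eventually.of_forall fun ξ => ?_)
    simp only [hx, hw]
    rw [sub_eq_add_neg, eChar_add_left, show eChar (-x) ξ = eChar (-ξ) x by unfold eChar; simp [inner_neg_right, real_inner_comm]]
    ring
  have e2 : ∀ R, avg R (fun t => eChar k t * convTD T (𝓕⁻ η) t) 0 = ∫ ξ, w ξ * avg R (eChar (k - ξ)) 0 ∂μ.tv := by
    intro R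
    rw [← fubini_pair μ.tv hwi k R]; simp only [e1]
  simp_rw [e2] at hm
  have h3 := lim_pair μ.tv hwi k
  have h4 := tendsto_nhds_unique hm h3
  rw [integral_indicator (measurableSet_singleton k), integral_singleton] at h4
  rw [h4, norm_smul, hw]
  simp only [hηk, one_mul]
  rw [Real.norm_of_nonneg measureReal_nonneg]
  by_cases h0 : μ.tv {k} = 0
  · simp [measureReal_def, h0]
  · have : ‖μ.density k‖ = 1 := by
      by_contra hne
      apply h0
      refine measure_mono_null ?_ (ae_iff.1 μ.density_norm)
      rintro _ rfl; exact hne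
    rw [this, mul_one]

lemma ii_of_i (hSAP : SAPD T) 
    (ha : ∀ (k : EuclideanSpace ℝ (Fin d)) (φ ψ : SchwartzMap (EuclideanSpace ℝ (Fin d)) ℂ),
      IsTestFn φ → (∫ x, φ x) = 1 →
      (∀ x, ψ x = Complex.exp (((2 * Real.pi * (inner ℝ x k : ℝ) : ℝ) : ℂ) * Complex.I) * φ x) →
      HasMean (fun t => eChar k t * convTD T ψ t) (a k))
    (μ : CMeasure (EuclideanSpace ℝ (Fin d))) (hμ : μ.Agrees (fourierTD T)) 
    (K : Set (EuclideanSpace ℝ (Fin d))) (hK : IsCompact K) :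
    Summable (fun k : ↥({k : EuclideanSpace ℝ (Fin d) | a k ≠ 0} ∩ K) => ‖a (k : EuclideanSpace ℝ (Fin d))‖) := by
  classical
  have := μ.locFin
  refine summable_of_sum_le (c := μ.tv.real K) (fun _ => norm_nonneg _) fun s => ?_
  have h1 : ∑ k ∈ s, ‖a (k : EuclideanSpace ℝ (Fin d))‖ ≤ ∑ k ∈ s.image Subtype.val, μ.tv.real {k} := by
    rw [Finset.sum_image (fun _ _ _ _ h => Subtype.val_injective h)]
    exact Finset.sum_le_sum fun k _ => coeff_of_measure hSAP ha μ hμ k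
  refine h1.trans ?_
  have hsub : (↑(s.image Subtype.val) : Set (EuclideanSpace ℝ (Fin d))) ⊆ K := by
    intro k hk
    simp only [Finset.coe_image, Set.mem_image, Finset.mem_coe] at hk
    obtain ⟨y, _, rfl⟩ := hk
    exact y.2.2
  calc ∑ k ∈ s.image Subtype.val, μ.tv.real {k} = μ.tv.real ↑(s.image Subtype.val) := by
        rw [sum_measureReal_singleton]
    _ ≤ _ := measureReal_mono hsub hK.measure_lt_top.ne

lemma i_of_ii (hSAP : SAPD T) 
    (ha : ∀ (k : EuclideanSpace ℝ (Fin d)) (φ ψ : SchwartzMap (EuclideanSpace ℝ (Fin d)) ℂ),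
      IsTestFn φ → (∫ x, φ x) = 1 →
      (∀ x, ψ x = Complex.exp (((2 * Real.pi * (inner ℝ x k : ℝ) : ℝ) : ℂ) * Complex.I) * φ x) →
      HasMean (fun t => eChar k t * convTD T ψ t) (a k))
    (hii : ∀ K : Set (EuclideanSpace ℝ (Fin d)), IsCompact K →
        Summable (fun k : ↥({k : EuclideanSpace ℝ (Fin d) | a k ≠ 0} ∩ K) => ‖a (k : EuclideanSpace ℝ (Fin d))‖)) :
    ∃ μ : CMeasure (EuclideanSpace ℝ (Fin d)), μ.Agrees (fourierTD T) := by
  classical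
  have hS := countable_S hSAP ha
  set S := {k : EuclideanSpace ℝ (Fin d) | a k ≠ 0} with hSdef
  set tv : Measure (EuclideanSpace ℝ (Fin d)) :=
    Measure.sum (fun k : S => ‖a (k : EuclideanSpace ℝ (Fin d))‖₊ • Measure.dirac (k : EuclideanSpace ℝ (Fin d))) with htv
  have hloc : IsLocallyFiniteMeasure tv := by
    refine ⟨fun x => ⟨closedBall x 1, closedBall_mem_nhds x one_pos, ?_⟩⟩
    rw [htv, Measure.sum_apply _ isClosed_closedBall.measurableSet]
    have h1 : Summable ((S ∩ closedBall x 1).indicator fun k => ‖a k‖) :=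
      summable_subtype_iff_indicator.1 (hii _ (isCompact_closedBall x 1))
    have h2 : Summable (fun k : S => (S ∩ closedBall x 1).indicator (fun k => ‖a k‖) (k : EuclideanSpace ℝ (Fin d))) :=
      h1.subtype S
    have h3 : ∀ k : S, (‖a (k : EuclideanSpace ℝ (Fin d))‖₊ • Measure.dirac (k : EuclideanSpace ℝ (Fin d))) (closedBall x 1)
        = ENNReal.ofReal ((S ∩ closedBall x 1).indicator (fun k => ‖a k‖) (k : EuclideanSpace ℝ (Fin d))) := by
      intro k
      rw [Measure.smul_apply, Measure.dirac_apply' _ isClosed_closedBall.measurableSet]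
      by_cases hk : (k : EuclideanSpace ℝ (Fin d)) ∈ closedBall x 1
      · rw [Set.indicator_of_mem hk, Set.indicator_of_mem (show (k : EuclideanSpace ℝ (Fin d)) ∈ S ∩ closedBall x 1 from ⟨k.2, hk⟩)]
        simp [ENNReal.smul_def]
        rfl
      · rw [Set.indicator_of_notMem hk, Set.indicator_of_notMem (show (k : EuclideanSpace ℝ (Fin d)) ∉ S ∩ closedBall x 1 from fun h => hk h.2)]
        simp
    simp_rw [h3]
    rw [← ENNReal.ofReal_tsum_of_nonneg (fun k => Set.indicator_nonneg (fun _ _ => norm_nonneg _) _) h2]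
    exact ENNReal.ofReal_lt_top
  set D : EuclideanSpace ℝ (Fin d) → ℂ := fun k => if a k = 0 then 1 else a k / ‖a k‖ with hD
  have hDn : ∀ k, ‖D k‖ = 1 := by
    intro k
    simp only [hD]
    split_ifs with h
    · simp
    · simp [h]
  have hDm : Measurable D := by
    refine (measurable_const (a := (1:ℂ))).measurable_of_countable_ne (hS.mono fun k hk => ?_)
    intro h
    apply hk
    simp [hD, h]
  let μ : CMeasure (EuclideanSpace ℝ (Fin d)) := ⟨tv, hloc, D, hDm, Eventually.of_forall hDn⟩
  refine ⟨μ, fun φ hφ => ?_⟩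
  rw [formula hSAP ha hφ (summable_of_ii hii hφ), CMeasure.pairing]
  change _ = ∫ x, φ x * D x ∂tv
  have hintg : Integrable (fun x => φ x * D x) tv := integrable_pair μ hφ
  rw [htv] at hintg ⊢
  rw [integral_sum_measure hintg]
  have h5 : ∀ k : S, ∫ x, φ x * D x ∂(‖a (k : EuclideanSpace ℝ (Fin d))‖₊ • Measure.dirac (k : EuclideanSpace ℝ (Fin d)))
      = a k * φ k := by
    intro k
    have hk : a k ≠ 0 := k.2
    rw [integral_smul_nnreal_measure, integral_dirac]
    simp only [hD, if_neg hk, NNReal.smul_def, coe_nnnorm, Complex.real_smul]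
    have : (‖a k‖ : ℂ) ≠ 0 := by simpa using hk
    field_simp
  simp_rw [h5]
  refine (tsum_subtype_eq_of_support_subset (f := fun k => a k * φ k) (s := S) fun k hk => ?_).symm
  intro h
  exact hk (by simp [h])
end
end Part10

/-- Let `T` be a strongly almost periodic distribution that is also a
tempered distribution, and let `a k` be its Fourier–Bohr coefficients, characterised by
`a k = M((χ̄_k T) * φ)` for test functions `φ` of total integral one, where
`((χ̄_k T) * φ)(t) = χ̄_k(t)·(T*(χ_k φ))(t)`. Then the Fourier–Bohr spectrum
`S = {k | a k ≠ 0}` is at most countable; `T̂` is a measure iff `Σ_{k ∈ S ∩ K} |a k| < ∞`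
for every compact `K`; and in that case `T̂ = Σ_{k ∈ S} a k δ_k` in the measure sense. -/
theorem sap_distribution_fourier_measure (d : ℕ)
    (T : SchwartzMap (EuclideanSpace ℝ (Fin d)) ℂ →L[ℂ] ℂ)
    (hSAP : SAPD T)
    (a : EuclideanSpace ℝ (Fin d) → ℂ)
    (ha : ∀ (k : EuclideanSpace ℝ (Fin d)) (φ ψ : SchwartzMap (EuclideanSpace ℝ (Fin d)) ℂ),
      IsTestFn φ → (∫ x, φ x) = 1 →
      (∀ x, ψ x = Complex.exp (((2 * Real.pi * (inner ℝ x k : ℝ) : ℝ) : ℂ) * Complex.I) * φ x) →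
      HasMean (fun t => eChar k t * convTD T ψ t) (a k)) :
    {k : EuclideanSpace ℝ (Fin d) | a k ≠ 0}.Countable ∧
    ((∃ μ : CMeasure (EuclideanSpace ℝ (Fin d)), μ.Agrees (fourierTD T)) ↔
      (∀ K : Set (EuclideanSpace ℝ (Fin d)), IsCompact K →
        Summable (fun k : ↥({k : EuclideanSpace ℝ (Fin d) | a k ≠ 0} ∩ K) =>
          ‖a (k : EuclideanSpace ℝ (Fin d))‖))) ∧
    ((∃ μ : CMeasure (EuclideanSpace ℝ (Fin d)), μ.Agrees (fourierTD T)) →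
      ∀ φ : SchwartzMap (EuclideanSpace ℝ (Fin d)) ℂ, IsTestFn φ →
        fourierTD T φ = ∑' k : EuclideanSpace ℝ (Fin d), a k * φ k) := by
  exact ⟨countable_S hSAP ha, ⟨fun ⟨μ, hμ⟩ K hK => ii_of_i hSAP ha μ hμ K hK,
    fun hii => i_of_ii hSAP ha hii⟩, fun ⟨μ, hμ⟩ φ hφ =>
    formula hSAP ha hφ (summable_of_ii (fun K hK => ii_of_i hSAP ha μ hμ K hK) hφ)⟩
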